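/- arXiv:math/0303324 — 2 statements merged into one kernel-verified Lean document; each statement's English description precedes it below -/
import Mathlib

section
/- There exists an ω-stable theory T of Morley rank 2 with NDOP (no dimensional order property) which has a model M and a subset A ⊆ M such that A is not benign in M. -/
open FirstOrder Language Cardinal

universe u

namespace Benign

variable {L : FirstOrder.Language.{u, u}} {M : Type u} [L.Structure M]

/-- Two tuples (indexed by a type `α`) realize the same complete `L`-type over the
parameter set `A`. -/
def SameTypeOver (A : Set M) {α : Type} (x y : α → M) : Prop :=
  ∀ φ : L.Formula (α ⊕ ↥A),
    φ.Realize (Sum.elim x Subtype.val) ↔ φ.Realize (Sum.elim y Subtype.val)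

/-- Two tuples realize the same strong type over `A`: they realize the same type over `A`,
and they are equivalent under every `A`-definable equivalence relation with finitely many
classes. -/
def SameStrongTypeOver (A : Set M) {α : Type} (x y : α → M) : Prop :=
  SameTypeOver (L := L) A x y ∧
    ∀ φ : L.Formula ((α ⊕ α) ⊕ ↥A),
      (Equivalence fun u v : α → M => φ.Realize (Sum.elim (Sum.elim u v) Subtype.val)) →
      (∃ k : ℕ, ∀ g : Fin (k + 1) → α → M, ∃ i j, i ≠ j ∧
          φ.Realize (Sum.elim (Sum.elim (g i) (g j)) Subtype.val)) →
      φ.Realize (Sum.elim (Sum.elim x y) Subtype.val)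

/-- The language consisting of a single unary predicate symbol `P`. -/
def unaryLang : FirstOrder.Language.{0, 0} := ⟨fun _ => Empty, fun n => PLift (n = 1)⟩

/-- The interpretation of the unary predicate `P` as membership in `A`. -/
def unaryStructure (A : Set M) : unaryLang.Structure M where
  funMap := fun f _ => f.elim
  RelMap := fun {n} r v => v (Fin.cast r.down.symm 0) ∈ A

/-- Two tuples realize the same type over `A` in the expanded language
`L* = L ∪ {P}` where the new unary predicate `P` is interpreted as `A`. -/
def SameLstarTypeOver (A : Set M) {α : Type} (x y : α → M) : Prop :=
  letI : unaryLang.Structure M := unaryStructure A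
  SameTypeOver (L := L.sum unaryLang) A x y

/-- `A` is benign in `M`: tuples with the same `L`-type over `A` have the same `L*`-type
over `A`. -/
def IsBenign (A : Set M) : Prop :=
  ∀ (n : ℕ) (x y : Fin n → M),
    SameTypeOver (L := L) A x y → SameLstarTypeOver (L := L) A x y

/-- `A` is weakly benign in `M`: tuples with the same strong type over `A` have the same
`L*`-type over `A`. -/
def IsWeaklyBenign (A : Set M) : Prop :=
  ∀ (n : ℕ) (x y : Fin n → M),
    SameStrongTypeOver (L := L) A x y → SameLstarTypeOver (L := L) A x y


/-- The cardinality of the theory: `|T| = |L| + ℵ₀`. -/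
noncomputable def cardL (L : FirstOrder.Language.{u, u}) : Cardinal.{u} :=
  L.card ⊔ ℵ₀

/-- `T` is stable in `κ`: over every parameter set of size at most `κ` in a model of `T`
there are at most `κ` complete types. -/
def StableIn (L : FirstOrder.Language.{u, u}) (T : L.Theory) (κ : Cardinal.{u}) : Prop :=
  ∀ (N : Type u) (_ : L.Structure N), N ⊨ T → ∀ A : Set N, #A ≤ κ →
    ∀ n : ℕ, #(((L[[↥A]]).completeTheory N).CompleteType (Fin n)) ≤ κ

/-- `T` is stable: stable in some cardinal. -/
def Stable (L : FirstOrder.Language.{u, u}) (T : L.Theory) : Prop :=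
  ∃ κ, StableIn L T κ

/-- `T` is superstable: stable in every cardinal `κ ≥ 2 ^ |T|`. -/
def Superstable (L : FirstOrder.Language.{u, u}) (T : L.Theory) : Prop :=
  ∀ κ : Cardinal.{u}, 2 ^ cardL L ≤ κ → StableIn L T κ

/-- `T` is `ω`-stable. -/
def OmegaStable (L : FirstOrder.Language.{u, u}) (T : L.Theory) : Prop :=
  StableIn L T ℵ₀

/-- `M` is `κ`-saturated as an `L'`-structure: every finitely satisfiable set of
`L'`-formulas in one free variable over fewer than `κ` parameters is realized. -/
def SaturatedIn (L' : FirstOrder.Language.{u, u}) [L'.Structure M] (κ : Cardinal.{u}) : Prop :=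
  ∀ S : Set M, #S < κ →
    ∀ p : Set (L'.Formula (Fin 1 ⊕ ↥S)),
      (∀ fs : Finset (L'.Formula (Fin 1 ⊕ ↥S)), ↑fs ⊆ p →
        ∃ x : M, ∀ φ ∈ fs, φ.Realize (Sum.elim ![x] Subtype.val)) →
      ∃ x : M, ∀ φ ∈ p, φ.Realize (Sum.elim ![x] Subtype.val)

/-- The pair `(M, A)` is `κ`-saturated as a structure in the language `L* = L ∪ {P}`. -/
def PairSaturated (A : Set M) (κ : Cardinal.{u}) : Prop :=
  letI : unaryLang.Structure M := unaryStructure A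
  SaturatedIn (M := M) (L.sum unaryLang) κ

/-- A subset `N ⊆ M` is (the universe of) an elementary substructure of `M`
(Tarski–Vaught test). -/
def ElemSubset (N : Set M) : Prop :=
  N.Nonempty ∧
    ∀ (n : ℕ) (φ : L.BoundedFormula (Fin n) 1) (a : Fin n → M), (∀ i, a i ∈ N) →
      (∃ x : M, φ.Realize a ![x]) → ∃ x ∈ N, φ.Realize a ![x]

/-- `B` is relatively `κ`-saturated in `A`: every type over a subset of `B` of size `< κ`
which is realized (by a finite tuple) in `A` is realized in `B`. -/
def RelKappaSaturated (κ : Cardinal.{u}) (B A : Set M) : Prop :=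
  B ⊆ A ∧
    ∀ S : Set M, S ⊆ B → #S < κ →
      ∀ (n : ℕ) (a : Fin n → M), (∀ i, a i ∈ A) →
        ∃ b : Fin n → M, (∀ i, b i ∈ B) ∧ SameTypeOver (L := L) S a b

/-- A subset `N ⊆ M` is `κ`-saturated (as a structure in its own right, computed inside
`M`): every set of formulas over `< κ` parameters from `N` which is finitely satisfiable
in `N` is realized in `N`. -/
def SubsetSaturated (κ : Cardinal.{u}) (N : Set M) : Prop :=
  ∀ S : Set M, S ⊆ N → #S < κ →
    ∀ p : Set (L.Formula (Fin 1 ⊕ ↥S)),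
      (∀ fs : Finset (L.Formula (Fin 1 ⊕ ↥S)), ↑fs ⊆ p →
        ∃ x ∈ N, ∀ φ ∈ fs, φ.Realize (Sum.elim ![x] Subtype.val)) →
      ∃ x ∈ N, ∀ φ ∈ p, φ.Realize (Sum.elim ![x] Subtype.val)

/-- `f` is a sequence of `m`-tuples which is indiscernible over `C`. -/
def IndiscOver (C : Set M) {m : ℕ} (f : ℕ → Fin m → M) : Prop :=
  ∀ (k : ℕ) (i j : Fin k → ℕ), StrictMono i → StrictMono j →
    SameTypeOver (L := L) C
      (fun s : Fin k × Fin m => f (i s.1) s.2) (fun s : Fin k × Fin m => f (j s.1) s.2)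

/-- The formula `φ(x̄, b)` divides over `C`: there is a `C`-indiscernible sequence starting
with `b` along which the instances of `φ` are `k`-inconsistent. -/
def Divides (C : Set M) {n m : ℕ} (φ : L.Formula (Fin n ⊕ Fin m)) (b : Fin m → M) : Prop :=
  ∃ f : ℕ → Fin m → M, f 0 = b ∧ IndiscOver (L := L) C f ∧
    ∃ k : ℕ, 0 < k ∧ ∀ i : Fin k → ℕ, StrictMono i →
      ¬ ∃ a : Fin n → M, ∀ j : Fin k, φ.Realize (Sum.elim a (f (i j)))

/-- `tp(a / B)` forks over `C`: the type implies a finite disjunction of formulas,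
each of which divides over `C`. -/
def TupForksOver {n : ℕ} (a : Fin n → M) (B C : Set M) : Prop :=
  ∃ (r : ℕ) (ms : Fin r → ℕ) (φ : ∀ i : Fin r, L.Formula (Fin n ⊕ Fin (ms i)))
    (b : ∀ i : Fin r, Fin (ms i) → M),
    (∀ i, Divides (L := L) C (φ i) (b i)) ∧
    ∀ a' : Fin n → M, SameTypeOver (L := L) B a a' →
      ∃ i, (φ i).Realize (Sum.elim a' (b i))

/-- The tuple `a` is independent from `X` over `C` (nonforking independence). -/
def TupIndepOver {n : ℕ} (a : Fin n → M) (X C : Set M) : Prop :=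
  ¬ TupForksOver (L := L) a (X ∪ C) C

/-- The set `Y` is independent from `X` over `C`: the type of every finite tuple from `Y`
over `X ∪ C` does not fork over `C`. -/
def IndepOver (Y X C : Set M) : Prop :=
  ∀ (n : ℕ) (a : Fin n → M), (∀ i, a i ∈ Y) → TupIndepOver (L := L) a X C

/-- `g` is an elementary map on the set `D`. -/
def ElemOn (D : Set M) (g : M → M) : Prop :=
  ∀ (n : ℕ) (a : Fin n → M), (∀ i, a i ∈ D) →
    SameTypeOver (L := L) (∅ : Set M) a (g ∘ a)

/-- The algebraic closure of `B` inside `M`. -/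
def aclSet (B : Set M) : Set M :=
  {x | ∃ φ : L.Formula (Fin 1 ⊕ ↥B), φ.Realize (Sum.elim ![x] Subtype.val) ∧
        {y : M | φ.Realize (Sum.elim ![y] Subtype.val)}.Finite}

/-- The type `tp(d / B)` is algebraic. -/
def AlgebraicTp (B : Set M) {n : ℕ} (d : Fin n → M) : Prop :=
  {d' : Fin n → M | SameTypeOver (L := L) B d d'}.Finite

/-- The types `tp(d / B)` and `tp(e / C)` are orthogonal: over any common extension `D`
of the domains, realizations of the respective nonforking extensions are independent. -/
def TypesOrthogonal {n m : ℕ} (B : Set M) (d : Fin n → M) (C : Set M) (e : Fin m → M) :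
    Prop :=
  ∀ (D : Set M) (d' : Fin n → M) (e' : Fin m → M), B ⊆ D → C ⊆ D →
    SameTypeOver (L := L) B d d' → ¬ TupForksOver (L := L) d' D B →
    SameTypeOver (L := L) C e e' → ¬ TupForksOver (L := L) e' D C →
    ¬ TupForksOver (L := L) d' (D ∪ Set.range e') D

/-- The type `tp(d / B)` is orthogonal to the set `A`: it is orthogonal to every complete
type over `acl(A)`. -/
def TypeOrthSet (B : Set M) {n : ℕ} (d : Fin n → M) (A : Set M) : Prop :=
  ∀ (m : ℕ) (e : Fin m → M), TypesOrthogonal (L := L) B d (aclSet (L := L) A) e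

/-- `tp(Na / Ma)` is orthogonal to the type `tp(e / Ma)`: the type over `Ma` of every
finite tuple from `Na` is orthogonal to it. -/
def SetTpOrth (Na Ma : Set M) {m : ℕ} (e : Fin m → M) : Prop :=
  ∀ (n : ℕ) (d : Fin n → M), (∀ i, d i ∈ Na) →
    TypesOrthogonal (L := L) Ma d Ma e

/-- The type `tp(d / B)` is regular: it is orthogonal to all of its forking extensions. -/
def TypeRegular (B : Set M) {n : ℕ} (d : Fin n → M) : Prop :=
  ∀ (D : Set M) (d' : Fin n → M), B ⊆ D →
    SameTypeOver (L := L) B d d' → TupForksOver (L := L) d' D B →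
    TypesOrthogonal (L := L) B d D d'

/-- The type `tp(d / B)` is stationary: it has a unique nonforking extension to every
superset of its domain. -/
def TypeStationary (B : Set M) {n : ℕ} (d : Fin n → M) : Prop :=
  ∀ D : Set M, B ⊆ D → ∀ d₁ d₂ : Fin n → M,
    SameTypeOver (L := L) B d d₁ → SameTypeOver (L := L) B d d₂ →
    ¬ TupForksOver (L := L) d₁ D B → ¬ TupForksOver (L := L) d₂ D B →
    SameTypeOver (L := L) D d₁ d₂

/-- `D` is `κ`-atomic over `B`: the type of every finite tuple from `D` over `B` is
implied by its restriction to a subset of `B` of size `< κ`. -/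
def KappaAtomicOver (κ : Cardinal.{u}) (D B : Set M) : Prop :=
  ∀ (n : ℕ) (d : Fin n → M), (∀ i, d i ∈ D) →
    ∃ S : Set M, S ⊆ B ∧ #S < κ ∧
      ∀ d' : Fin n → M, SameTypeOver (L := L) S d d' → SameTypeOver (L := L) B d d'

/-- `N` is `κ`-prime over `X`: `N` is a `κ`-saturated elementary substructure containing
`X` which elementarily embeds over `X` into every `κ`-saturated elementary substructure
containing `X`. -/
def KappaPrimeOver (κ : Cardinal.{u}) (N X : Set M) : Prop :=
  ElemSubset (L := L) N ∧ X ⊆ N ∧ SubsetSaturated (L := L) κ N ∧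
    ∀ N' : Set M, ElemSubset (L := L) N' → X ⊆ N' → SubsetSaturated (L := L) κ N' →
      ∃ g : M → M, ElemOn (L := L) N g ∧ (∀ x ∈ X, g x = x) ∧ g '' N ⊆ N'

/-- `Ma` is `A`-full in `M`. -/
def AFull (A Ma : Set M) (κ : Cardinal.{u}) : Prop :=
  ∀ N : Set M, KappaPrimeOver (L := L) κ N (Ma ∪ A) →
    ∀ C0 C1 C2 : Set M, C0 ⊆ Ma → C1 ⊆ A → C0 ⊆ C2 → C1 ⊆ C2 → C2 ⊆ N →
      #C0 ≤ cardL L → #C1 ≤ cardL L → #C2 ≤ cardL L →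
      ∃ f : M → M, ElemOn (L := L) (C1 ∪ C2) f ∧ (∀ x ∈ C0, f x = x) ∧
        f '' (C1 ∪ C2) ⊆ Ma ∧ f '' C1 ⊆ A ∧
        (IndepOver (L := L) C2 A C1 → IndepOver (L := L) (f '' C2) A (f '' C1))

/-- `(M₁, A₁) ∈ K_c`. -/
structure Kc (κ : Cardinal.{u}) (A : Set M) (c : M) (M₁ A₁ : Set M) : Prop where
  elem : ElemSubset (L := L) M₁
  mem : c ∈ M₁
  relSat : RelKappaSaturated (L := L) κ A₁ A
  sub : A₁ ⊆ M₁
  indep : IndepOver (L := L) M₁ A A₁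
  cardA₁ : #A₁ ≤ κ
  cardM₁ : #M₁ ≤ κ
  sat : SubsetSaturated (L := L) κ M₁

/-- `⟨A₁, Ma, Mb, Na, g⟩ ∈ K¹_{a,b}`. -/
structure K1 (κ : Cardinal.{u}) (A : Set M) (a b : M) (A₁ Ma Mb Na : Set M)
    (g : M → M) : Prop where
  ka : Kc (L := L) κ A a Ma A₁
  kb : Kc (L := L) κ A b Mb A₁
  gBij : Set.BijOn g Ma Mb
  gFix : ∀ x ∈ A₁, g x = x
  gElem : ElemOn (L := L) Ma g
  gab : g a = b
  sub : Ma ⊆ Na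
  elemNa : ElemSubset (L := L) Na
  satNa : SubsetSaturated (L := L) κ Na
  cardNa : #Na = κ
  indepNa : IndepOver (L := L) Na A A₁

/-- `⟨A₁, Ma, Mb, Na, g⟩ ∈ K²_{a,b}`: additionally `g` is an isomorphism of `Ma^eq` onto
`Mb^eq` over `A₁^eq`, i.e. `g` preserves strong types over `A₁`. -/
def K2 (κ : Cardinal.{u}) (A : Set M) (a b : M) (A₁ Ma Mb Na : Set M)
    (g : M → M) : Prop :=
  K1 (L := L) κ A a b A₁ Ma Mb Na g ∧
    ∀ (n : ℕ) (t : Fin n → M), (∀ i, t i ∈ Ma) →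
      SameStrongTypeOver (L := L) A₁ t (g ∘ t)

/-- `K^i_{a,b}` for `i ∈ {1,2}` (`two = false` gives `K¹`, `two = true` gives `K²`). -/
def Ki (two : Bool) (κ : Cardinal.{u}) (A : Set M) (a b : M) (A₁ Ma Mb Na : Set M)
    (g : M → M) : Prop :=
  if two then K2 (L := L) κ A a b A₁ Ma Mb Na g
  else K1 (L := L) κ A a b A₁ Ma Mb Na g

/-- `d'` realizes `g(tp(d / Ma))`. -/
def RealizesGType (Ma : Set M) (g : M → M) {n : ℕ} (d d' : Fin n → M) : Prop :=
  ∀ (k : ℕ) (m : Fin k → M), (∀ i, m i ∈ Ma) →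
    ∀ φ : L.Formula (Fin n ⊕ Fin k),
      φ.Realize (Sum.elim d m) ↔ φ.Realize (Sum.elim d' (g ∘ m))

/-- The data `⟨A₁, Ma, Mb, Na, g⟩ ∈ K²_{a,b}` satisfies the conclusion of the
characterization of failure of weak benignity (conditions (a)–(f) of the main lemma). -/
structure CharWitness (κ : Cardinal.{u}) (A : Set M) (a b : M) (Astar Ma Mb Na : Set M)
    (g : M → M) : Prop where
  k2 : K2 (L := L) κ A a b Astar Ma Mb Na g
  ne : Ma ≠ Na
  full : AFull (L := L) A Ma κ
  indepNa : IndepOver (L := L) Na A Astar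
  orth : ∀ (n : ℕ) (e : Fin n → M), ¬ AlgebraicTp (L := L) Ma e →
    TypeOrthSet (L := L) Ma e A → SetTpOrth (L := L) Na Ma e
  noCopy : ∀ (n : ℕ) (d : Fin n → M), (∀ i, d i ∈ Na) → ¬ (∀ i, d i ∈ Ma) →
    ¬ ∃ d' : Fin n → M, RealizesGType (L := L) Ma g d d' ∧
        TupIndepOver (L := L) d' A Mb
  gStrong : ∀ (n : ℕ) (t : Fin n → M), (∀ i, t i ∈ Ma) →
    SameStrongTypeOver (L := L) Astar t (g ∘ t)

/-- An `L*`-elementary map from `(M, A)` to `(M', A')`. -/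
def LstarElementary {M' : Type u} [L.Structure M'] (A : Set M) (A' : Set M')
    (h : M → M') : Prop :=
  ∀ (n : ℕ) (φ : (L.sum unaryLang).Formula (Fin n)) (v : Fin n → M),
    (letI : unaryLang.Structure M := unaryStructure A; φ.Realize v) ↔
    (letI : unaryLang.Structure M' := unaryStructure A'; φ.Realize (h ∘ v))

/-- The family `I` of tuples is independent over `Y`: each member is independent over `Y`
from the union of the other members. -/
def IndepFamily (Y : Set M) (I : Set (Σ m : ℕ, Fin m → M)) : Prop :=
  ∀ t ∈ I, TupIndepOver (L := L) t.2 (⋃ s ∈ I \ {t}, Set.range s.2) Y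

/-- `tp(t / Y)` belongs to the family `P` of regular stationary types nonorthogonal to
`p* = tp(dstar / Pbase)`. -/
def InP {nd : ℕ} (Pbase : Set M) (dstar : Fin nd → M) {m : ℕ} (Y : Set M)
    (t : Fin m → M) : Prop :=
  TypeRegular (L := L) Y t ∧ TypeStationary (L := L) Y t ∧
    ¬ TypesOrthogonal (L := L) Y t Pbase dstar

/-- The `P`-weight `w_P(X, Y)` of the set `X` over the set `Y`, where
`P = {p : p regular, stationary, nonorthogonal to p* = tp(dstar / Pbase)}`: the supremum
of cardinalities of `Y`-independent families of tuples realizing types in `P` over `Y`,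
each of which forks with `X` over `Y`. -/
noncomputable def wP {nd : ℕ} (Pbase : Set M) (dstar : Fin nd → M) (X Y : Set M) :
    Cardinal.{u} :=
  sSup { c : Cardinal.{u} | ∃ I : Set (Σ m : ℕ, Fin m → M), #I = c ∧
    IndepFamily (L := L) Y I ∧
    ∀ t ∈ I, InP (L := L) Pbase dstar Y t.2 ∧
      TupForksOver (L := L) t.2 (Y ∪ X) Y }

/-- The set of realizations in `X` of the (1-)type `tp(e / B)`. -/
def qSet (B : Set M) (e : M) (X : Set M) : Set M :=
  {x ∈ X | SameTypeOver (L := L) B ![x] ![e]}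

/-- `dim(tp(d / B), N)` is finite: there is no infinite sequence of realizations of the
type in `N`, chosen successively independent. -/
def DimFinite (B : Set M) {n : ℕ} (d : Fin n → M) (N : Set M) : Prop :=
  ¬ ∃ f : ℕ → Fin n → M,
    ∀ j : ℕ, (∀ i, f j i ∈ N) ∧ SameTypeOver (L := L) B d (f j) ∧
      ¬ TupForksOver (L := L) (f j) (B ∪ ⋃ l ∈ Set.Iio j, Set.range (f l)) B

/-- The definable subsets (with parameters) of `N^n`. -/
def DefSet (N : Type u) [L.Structure N] (n : ℕ) : Set (Set (Fin n → N)) :=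
  {X | ∃ (m : ℕ) (φ : L.Formula (Fin n ⊕ Fin m)) (b : Fin m → N),
    X = {v | φ.Realize (Sum.elim v b)}}

/-- The Morley rank of the (definable) set `X` is at least `α`. -/
def MRge {N : Type u} [L.Structure N] {n : ℕ} (X : Set (Fin n → N)) (α : Ordinal.{u}) :
    Prop :=
  X.Nonempty ∧ ∀ β, β < α → ∃ f : ℕ → Set (Fin n → N),
    (∀ i, f i ∈ DefSet (L := L) N n ∧ f i ⊆ X ∧ MRge (f i) β) ∧
    Pairwise (Function.onFun Disjoint f)
termination_by α
decreasing_by exact ‹β < α›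

/-- The theory `T` has Morley rank `2`: in every `ℵ₀`-saturated model, the rank of the
whole universe (in one variable) is exactly `2`. -/
def MorleyRankTwo (L : FirstOrder.Language.{u, u}) (T : L.Theory) : Prop :=
  ∀ (N : Type u) (_ : L.Structure N), N ⊨ T → SaturatedIn (M := N) L ℵ₀ →
    MRge (L := L) (Set.univ : Set (Fin 1 → N)) 2 ∧
      ¬ MRge (L := L) (Set.univ : Set (Fin 1 → N)) 3

/-- `T` has NDOP: in any sufficiently saturated model, for elementary substructures
`N₁, N₂` independent over a common elementary substructure `N₀`, and `N₃` prime over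
`N₁ ∪ N₂`, every nonalgebraic type over `N₃` is nonorthogonal to `N₁` or to `N₂`. -/
def NDOP (L : FirstOrder.Language.{u, u}) (T : L.Theory) : Prop :=
  ∀ (N : Type u) (_ : L.Structure N), N ⊨ T →
    SaturatedIn (M := N) L (Order.succ ℵ₀) →
    ∀ N₀ N₁ N₂ N₃ : Set N,
      ElemSubset (L := L) N₀ → ElemSubset (L := L) N₁ → ElemSubset (L := L) N₂ →
      N₀ ⊆ N₁ → N₀ ⊆ N₂ → IndepOver (L := L) N₁ N₂ N₀ →
      KappaPrimeOver (L := L) ℵ₀ N₃ (N₁ ∪ N₂) →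
      ∀ (n : ℕ) (d : Fin n → N), ¬ AlgebraicTp (L := L) N₃ d →
        ¬ TypeOrthSet (L := L) N₃ d N₁ ∨ ¬ TypeOrthSet (L := L) N₃ d N₂

/-- The only relation symbol of `rookLang`, of arity four. -/
inductive RookRel : ℕ → Type
  | q : RookRel 4

/-- The language with a single quaternary relation symbol. -/
def rookLang : FirstOrder.Language.{0, 0} := ⟨fun _ => Empty, RookRel⟩

/-- The interpretation of the symbol of `rookLang`: the pairs `a, b` and `c, d` are either both
contained in a row or both contained in a column. -/
def Parallel {N : Type} [rookLang.Structure N] (a b c d : N) : Prop :=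
  Structure.RelMap (L := rookLang) RookRel.q ![a, b, c, d]

/-- An identification of a `rookLang`-structure with a product of two infinite sets, with
coordinate functions `x` and `y`. -/
structure Coord (N : Type) [rookLang.Structure N] (X Y : Type) where
  x : N → X
  y : N → Y
  pt : X → Y → N
  x_pt : ∀ a b, x (pt a b) = a
  y_pt : ∀ a b, y (pt a b) = b
  ext : ∀ p q, x p = x q → y p = y q → p = q
  infX : Infinite X
  infY : Infinite Y
  parallel : ∀ a b c d, Parallel a b c d ↔ (x a = x b ∧ x c = x d) ∨ (y a = y b ∧ y c = y d)

/-- Exchanging the two coordinates. -/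
def Coord.swap {N X Y : Type} [rookLang.Structure N] (c : Coord N X Y) : Coord N Y X where
  x := c.y
  y := c.x
  pt a b := c.pt b a
  x_pt a b := c.y_pt b a
  y_pt a b := c.x_pt b a
  ext p q h₁ h₂ := c.ext p q h₂ h₁
  infX := c.infY
  infY := c.infX
  parallel a b d e := (c.parallel a b d e).trans or_comm

/-- Two families have the same equality pattern. -/
def SamePattern {α X X' : Type} (f : α → X) (g : α → X') : Prop :=
  ∀ i j, f i = f j ↔ g i = g j

/-- Two families of points have the same equality patterns in both coordinates. -/
def Matching {N N' X Y X' Y' α : Type} [rookLang.Structure N] [rookLang.Structure N']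
    (c : Coord N X Y) (c' : Coord N' X' Y') (u : α → N) (v : α → N') : Prop :=
  SamePattern (fun i => c.x (u i)) (fun i => c'.x (v i)) ∧
    SamePattern (fun i => c.y (u i)) (fun i => c'.y (v i))

section Pattern

variable {α X X' : Type}

theorem SamePattern.symm {f : α → X} {g : α → X'} (h : SamePattern f g) : SamePattern g f :=
  fun i j => (h i j).symm

theorem SamePattern.exists_extend [Finite α] [Infinite X'] {f : α → X} {g : α → X'}
    (h : SamePattern f g) (a : X) : ∃ b : X', ∀ i, f i = a ↔ g i = b := by
  by_cases ha : ∃ i, f i = a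
  · obtain ⟨i, rfl⟩ := ha
    exact ⟨g i, fun j => h j i⟩
  · obtain ⟨b, hb⟩ := (Set.finite_range g).exists_notMem
    push Not at ha
    exact ⟨b, fun i => iff_of_false (ha i) fun h' => hb ⟨i, h'⟩⟩

theorem SamePattern.snoc {n : ℕ} {f : α → X} {g : α → X'} {xs : Fin n → X} {ys : Fin n → X'}
    (h : SamePattern (Sum.elim f xs) (Sum.elim g ys)) {a : X} {b : X'}
    (hab : ∀ i, Sum.elim f xs i = a ↔ Sum.elim g ys i = b) :
    SamePattern (Sum.elim f (Fin.snoc xs a : Fin (n + 1) → X))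
      (Sum.elim g (Fin.snoc ys b : Fin (n + 1) → X')) := by
  have key : ∀ i : α ⊕ Fin (n + 1), (∃ j : α ⊕ Fin n,
      Sum.elim f (Fin.snoc xs a : Fin (n + 1) → X) i = Sum.elim f xs j ∧
      Sum.elim g (Fin.snoc ys b : Fin (n + 1) → X') i = Sum.elim g ys j) ∨
      (Sum.elim f (Fin.snoc xs a : Fin (n + 1) → X) i = a ∧
      Sum.elim g (Fin.snoc ys b : Fin (n + 1) → X') i = b) := by
    rintro (i | i)
    · exact Or.inl ⟨Sum.inl i, rfl, rfl⟩
    · induction i using Fin.lastCases with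
      | last => right; simp
      | cast i => left; exact ⟨Sum.inr i, by simp, by simp⟩
  intro i j
  rcases key i with ⟨i', hi, hi'⟩ | ⟨hi, hi'⟩ <;> rcases key j with ⟨j', hj, hj'⟩ | ⟨hj, hj'⟩ <;>
    rw [hi, hi', hj, hj']
  · exact h i' j'
  · exact hab i'
  · rw [eq_comm, hab j', eq_comm]
  · simp

theorem comp_snoc {n : ℕ} {N : Type} (x : N → X) (u : α → N) (xs : Fin n → N) (a : N) :
    (fun i => x (Sum.elim u (Fin.snoc xs a : Fin (n + 1) → N) i)) =
      Sum.elim (fun i => x (u i)) (Fin.snoc (fun i => x (xs i)) (x a) : Fin (n + 1) → X) := by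
  funext i
  rcases i with i | i
  · rfl
  · induction i using Fin.lastCases <;> simp

theorem comp_elim {β : Type} {N : Type} (x : N → X) (u : α → N) (xs : β → N) :
    (fun i => x (Sum.elim u xs i)) = Sum.elim (fun i => x (u i)) (fun i => x (xs i)) := by
  funext i
  rcases i with i | i <;> rfl

end Pattern

section Coordinates

variable {N N' X Y X' Y' α : Type} [rookLang.Structure N] [rookLang.Structure N']

theorem Matching.symm {c : Coord N X Y} {c' : Coord N' X' Y'} {u : α → N} {v : α → N'}
    (h : Matching c c' u v) : Matching c' c v u :=
  ⟨h.1.symm, h.2.symm⟩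

theorem Matching.swap {c : Coord N X Y} {c' : Coord N' X' Y'} {u : α → N} {v : α → N'}
    (h : Matching c c' u v) : Matching c.swap c'.swap u v :=
  ⟨h.2, h.1⟩

theorem Matching.comp {β : Type} {c : Coord N X Y} {c' : Coord N' X' Y'} {u : α → N} {v : α → N'}
    (h : Matching c c' u v) (f : β → α) : Matching c c' (u ∘ f) (v ∘ f) :=
  ⟨fun i j => h.1 (f i) (f j), fun i j => h.2 (f i) (f j)⟩

theorem Matching.eq_iff {c : Coord N X Y} {c' : Coord N' X' Y'} {u : α → N} {v : α → N'}
    (h : Matching c c' u v) (i j : α) : u i = u j ↔ v i = v j :=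
  ⟨fun e => c'.ext _ _ ((h.1 i j).1 (congrArg c.x e)) ((h.2 i j).1 (congrArg c.y e)),
    fun e => c.ext _ _ ((h.1 i j).2 (congrArg c'.x e)) ((h.2 i j).2 (congrArg c'.y e))⟩

theorem Matching.parallel_iff {c : Coord N X Y} {c' : Coord N' X' Y'} {u : α → N} {v : α → N'}
    (h : Matching c c' u v) (i j k l : α) :
    Parallel (u i) (u j) (u k) (u l) ↔ Parallel (v i) (v j) (v k) (v l) := by
  rw [c.parallel, c'.parallel]
  exact or_congr (and_congr (h.1 i j) (h.1 k l)) (and_congr (h.2 i j) (h.2 k l))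

theorem Matching.exists_extend [Finite α] {n : ℕ} {c : Coord N X Y} {c' : Coord N' X' Y'}
    {u : α → N} {v : α → N'} {xs : Fin n → N} {ys : Fin n → N'}
    (h : Matching c c' (Sum.elim u xs) (Sum.elim v ys)) (a : N) :
    ∃ b : N', Matching c c' (Sum.elim u (Fin.snoc xs a : Fin (n + 1) → N))
      (Sum.elim v (Fin.snoc ys b : Fin (n + 1) → N')) := by
  have := c'.infX
  have := c'.infY
  obtain ⟨h₁, h₂⟩ := h
  simp only [comp_elim] at h₁ h₂
  obtain ⟨b₁, hb₁⟩ := h₁.exists_extend (c.x a)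
  obtain ⟨b₂, hb₂⟩ := h₂.exists_extend (c.y a)
  refine ⟨c'.pt b₁ b₂, ?_, ?_⟩
  · rw [comp_snoc, comp_snoc, c'.x_pt]
    exact h₁.snoc hb₁
  · rw [comp_snoc, comp_snoc, c'.y_pt]
    exact h₂.snoc hb₂

theorem exists_realize_term_eq (t : rookLang.Term α) : ∃ i : α, t = Term.var i := by
  cases t with
  | var i => exact ⟨i, rfl⟩
  | func f _ => exact f.elim

/-- Back-and-forth: matching finite tuples satisfy the same formulas. -/
theorem Matching.realize_boundedFormula_iff [Finite α] {c : Coord N X Y} {c' : Coord N' X' Y'}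
    {n : ℕ} (φ : rookLang.BoundedFormula α n) {u : α → N} {v : α → N'} {xs : Fin n → N}
    {ys : Fin n → N'} (h : Matching c c' (Sum.elim u xs) (Sum.elim v ys)) :
    φ.Realize u xs ↔ φ.Realize v ys := by
  induction φ with
  | falsum => rfl
  | equal t₁ t₂ =>
    obtain ⟨i, rfl⟩ := exists_realize_term_eq t₁
    obtain ⟨j, rfl⟩ := exists_realize_term_eq t₂
    exact h.eq_iff i j
  | rel R ts =>
    cases R
    choose f hf using fun i => exists_realize_term_eq (ts i)
    have e₁ : (fun i => (ts i).realize (Sum.elim u xs)) = ![Sum.elim u xs (f 0),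
        Sum.elim u xs (f 1), Sum.elim u xs (f 2), Sum.elim u xs (f 3)] := by
      funext i
      rw [hf i]
      fin_cases i <;> rfl
    have e₂ : (fun i => (ts i).realize (Sum.elim v ys)) = ![Sum.elim v ys (f 0),
        Sum.elim v ys (f 1), Sum.elim v ys (f 2), Sum.elim v ys (f 3)] := by
      funext i
      rw [hf i]
      fin_cases i <;> rfl
    simp only [BoundedFormula.Realize]
    rw [e₁, e₂]
    exact h.parallel_iff _ _ _ _
  | imp _ _ ih₁ ih₂ => exact imp_congr (ih₁ h) (ih₂ h)
  | all φ ih =>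
    constructor
    · intro H b
      obtain ⟨a, ha⟩ := h.symm.exists_extend b
      exact (ih ha.symm).1 (H a)
    · intro H a
      obtain ⟨b, hb⟩ := h.exists_extend a
      exact (ih hb).2 (H b)

theorem Matching.realize_iff_of_freeVarFinset [DecidableEq α] {c : Coord N X Y}
    {c' : Coord N' X' Y'} (φ : rookLang.Formula α) {u : α → N} {v : α → N'}
    (h : Matching c c' (fun i : φ.freeVarFinset => u i) (fun i : φ.freeVarFinset => v i)) :
    φ.Realize u ↔ φ.Realize v := by
  have key : Matching c c' (Sum.elim (u ∘ (Subtype.val : ↥(φ.freeVarFinset : Set α) → α)) default)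
      (Sum.elim (v ∘ (Subtype.val : ↥(φ.freeVarFinset : Set α) → α)) (default : Fin 0 → N')) := by
    have := h.comp (Sum.elim (fun i : ↥(φ.freeVarFinset : Set α) => (⟨i, i.2⟩ : φ.freeVarFinset))
      (fun i : Fin 0 => i.elim0))
    convert this using 1 <;> · funext i; rcases i with i | i; rfl; exact i.elim0
  have := Matching.realize_boundedFormula_iff
    (φ.restrictFreeVar (Set.inclusion (Set.Subset.refl (φ.freeVarFinset : Set α)))) key
  rwa [BoundedFormula.realize_restrictFreeVar', BoundedFormula.realize_restrictFreeVar'] at this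

theorem Matching.realize_iff {c : Coord N X Y} {c' : Coord N' X' Y'}
    (φ : rookLang.Formula α) {u : α → N} {v : α → N'} (h : Matching c c' u v) :
    φ.Realize u ↔ φ.Realize v := by
  classical
  exact Matching.realize_iff_of_freeVarFinset φ (h.comp (Subtype.val : φ.freeVarFinset → α))

/-- Families on which `Parallel` and equality agree are matching, possibly after exchanging the
coordinates. -/
theorem matching_or_matching_swap (c : Coord N X Y) (c' : Coord N' X' Y') {u : α → N} {v : α → N'}
    (he : ∀ i j, u i = u j ↔ v i = v j)
    (hp : ∀ i j k l, Parallel (u i) (u j) (u k) (u l) ↔ Parallel (v i) (v j) (v k) (v l)) :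
    Matching c c' u v ∨ Matching c c'.swap u v := by
  have main : ∀ {X Y X' Y' : Type} (c : Coord N X Y) (c' : Coord N' X' Y') (a b : α),
      u a ≠ u b → c.x (u a) = c.x (u b) → c'.x (v a) = c'.x (v b) → Matching c c' u v := by
    intro X Y X' Y' c c' a b hab h h'
    have hy : c.y (u a) ≠ c.y (u b) := fun e => hab (c.ext _ _ h e)
    have hy' : c'.y (v a) ≠ c'.y (v b) := fun e => hab ((he a b).2 (c'.ext _ _ h' e))
    have h₁ : ∀ i j, c.x (u i) = c.x (u j) ↔ c'.x (v i) = c'.x (v j) := by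
      intro i j
      have := hp a b i j
      rw [c.parallel, c'.parallel] at this
      simpa [h, h', hy, hy'] using this
    refine ⟨h₁, fun i j => ?_⟩
    have := hp i j i j
    rw [c.parallel, c'.parallel] at this
    have e := he i j
    have e₁ := c.ext (u i) (u j)
    have e₂ := c'.ext (v i) (v j)
    have e₃ := h₁ i j
    have e₄ : u i = u j → c.y (u i) = c.y (u j) := congrArg _
    have e₅ : v i = v j → c'.y (v i) = c'.y (v j) := congrArg _
    grind
  have swap_swap : ∀ {u : α → N} {v : α → N'}, Matching c.swap c' u v → Matching c c'.swap u v :=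
    fun h => ⟨h.2, h.1⟩
  have hcol : ∀ a b, Parallel (v a) (v b) (v a) (v b) →
      c'.x (v a) = c'.x (v b) ∨ c'.y (v a) = c'.y (v b) := by
    intro a b h
    rw [c'.parallel] at h
    grind
  by_cases hx : ∃ a b, u a ≠ u b ∧ c.x (u a) = c.x (u b)
  · obtain ⟨a, b, hab, h⟩ := hx
    rcases hcol a b ((hp a b a b).1 ((c.parallel _ _ _ _).2 (Or.inl ⟨h, h⟩))) with h' | h'
    · exact Or.inl (main c c' a b hab h h')
    · exact Or.inr (main c c'.swap a b hab h h')
  by_cases hy : ∃ a b, u a ≠ u b ∧ c.y (u a) = c.y (u b)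
  · obtain ⟨a, b, hab, h⟩ := hy
    rcases hcol a b ((hp a b a b).1 ((c.parallel _ _ _ _).2 (Or.inr ⟨h, h⟩))) with h' | h'
    · exact Or.inr (swap_swap (main c.swap c' a b hab h h'))
    · exact Or.inl (main c.swap c'.swap a b hab h h').swap
  push Not at hx hy
  left
  have none : ∀ i j, u i ≠ u j → c'.x (v i) ≠ c'.x (v j) ∧ c'.y (v i) ≠ c'.y (v j) := by
    intro i j hij
    have := hp i j i j
    rw [c.parallel, c'.parallel] at this
    have h₁ := hx i j hij
    have h₂ := hy i j hij
    grind
  refine ⟨fun i j => ?_, fun i j => ?_⟩ <;> by_cases hij : u i = u j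
  · simp [hij, (he i j).1 hij]
  · exact iff_of_false (hx i j hij) (none i j hij).1
  · simp [hij, (he i j).1 hij]
  · exact iff_of_false (hy i j hij) (none i j hij).2

end Coordinates

section Grid

/-- The atomic formula `Parallel`. -/
def parallelVar {α : Type} {n : ℕ} (i j k l : α ⊕ Fin n) : rookLang.BoundedFormula α n :=
  Relations.boundedFormula (L := rookLang) RookRel.q
    ![Term.var i, Term.var j, Term.var k, Term.var l]

/-- The atomic formula `Parallel` in bound variables. -/
abbrev parallelFormula {n : ℕ} (i j k l : Fin n) : rookLang.BoundedFormula Empty n :=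
  parallelVar (Sum.inr i) (Sum.inr j) (Sum.inr k) (Sum.inr l)

variable {N : Type} [rookLang.Structure N]

@[simp]
theorem realize_parallelVar {α : Type} {n : ℕ} (i j k l : α ⊕ Fin n) (v : α → N) (xs : Fin n → N) :
    (parallelVar i j k l).Realize v xs ↔ Parallel (Sum.elim v xs i) (Sum.elim v xs j)
      (Sum.elim v xs k) (Sum.elim v xs l) := by
  refine iff_of_eq (congrArg (Structure.RelMap (L := rookLang) RookRel.q) ?_)
  funext m
  fin_cases m <;> rfl

/-- The pairs `a, b` and `c, d` witness the two directions of a grid. -/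
structure IsFrame (a b c d : N) : Prop where
  ne : a ≠ b
  self : Parallel a b a b
  ne' : c ≠ d
  self' : Parallel c d c d
  refl : ∀ p, Parallel a b p p
  symm : ∀ p q, Parallel a b p q → Parallel a b q p
  trans : ∀ p q r, Parallel a b p q → Parallel a b q r → Parallel a b p r
  refl' : ∀ p, Parallel c d p p
  symm' : ∀ p q, Parallel c d p q → Parallel c d q p
  trans' : ∀ p q r, Parallel c d p q → Parallel c d q r → Parallel c d p r
  eq : ∀ p q, Parallel a b p q → Parallel c d p q → p = q
  exists_meet : ∀ p q, ∃ z, Parallel a b p z ∧ Parallel c d z q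
  parallel : ∀ p q r s, Parallel p q r s ↔
    (Parallel a b p q ∧ Parallel a b r s) ∨ (Parallel c d p q ∧ Parallel c d r s)

/-- The sentence stating that a frame exists. -/
def frameSentence : rookLang.Sentence :=
  (((∼(Term.bdEqual (Term.var (Sum.inr 0)) (Term.var (Sum.inr 1))) ⊓
    parallelFormula 0 1 0 1 ⊓
    ∼(Term.bdEqual (Term.var (Sum.inr 2)) (Term.var (Sum.inr 3))) ⊓
    parallelFormula 2 3 2 3 ⊓
    (parallelFormula 0 1 4 4).all ⊓
    (parallelFormula 0 1 4 5 ⟹ parallelFormula 0 1 5 4).all.all ⊓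
    (parallelFormula 0 1 4 5 ⟹ parallelFormula 0 1 5 6 ⟹ parallelFormula 0 1 4 6).all.all.all ⊓
    (parallelFormula 2 3 4 4).all ⊓
    (parallelFormula 2 3 4 5 ⟹ parallelFormula 2 3 5 4).all.all ⊓
    (parallelFormula 2 3 4 5 ⟹ parallelFormula 2 3 5 6 ⟹ parallelFormula 2 3 4 6).all.all.all ⊓
    (parallelFormula 0 1 4 5 ⟹ parallelFormula 2 3 4 5 ⟹
      Term.bdEqual (Term.var (Sum.inr 4)) (Term.var (Sum.inr 5))).all.all ⊓
    (parallelFormula 0 1 4 6 ⊓ parallelFormula 2 3 6 5).ex.all.all ⊓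
    ((parallelFormula 4 5 6 7).iff ((parallelFormula 0 1 4 5 ⊓ parallelFormula 0 1 6 7) ⊔
      (parallelFormula 2 3 4 5 ⊓ parallelFormula 2 3 6 7))).all.all.all.all :
    rookLang.BoundedFormula Empty 4).ex.ex.ex.ex : rookLang.BoundedFormula Empty 0))

theorem realize_frameSentence :
    Sentence.Realize N frameSentence ↔ ∃ a b c d : N, IsFrame a b c d := by
  simp only [frameSentence, Sentence.Realize, Formula.Realize, BoundedFormula.realize_ex]
  refine exists_congr fun a => exists_congr fun b => exists_congr fun c => exists_congr fun d => ?_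
  simp only [BoundedFormula.realize_inf, BoundedFormula.realize_not, BoundedFormula.realize_bdEqual,
    BoundedFormula.realize_all, BoundedFormula.realize_imp, BoundedFormula.realize_ex,
    BoundedFormula.realize_iff, BoundedFormula.realize_sup, realize_parallelVar,
    Term.realize_var, Sum.elim_inr]
  constructor
  · rintro ⟨⟨⟨⟨⟨⟨⟨⟨⟨⟨⟨⟨h₁, h₂⟩, h₃⟩, h₄⟩, h₅⟩, h₆⟩, h₇⟩, h₈⟩, h₉⟩, h₁₀⟩, h₁₁⟩, h₁₂⟩, h₁₃⟩
    exact ⟨h₁, h₂, h₃, h₄, h₅, h₆, h₇, h₈, h₉, h₁₀, h₁₁, h₁₂, h₁₃⟩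
  · rintro ⟨h₁, h₂, h₃, h₄, h₅, h₆, h₇, h₈, h₉, h₁₀, h₁₁, h₁₂, h₁₃⟩
    exact ⟨⟨⟨⟨⟨⟨⟨⟨⟨⟨⟨⟨h₁, h₂⟩, h₃⟩, h₄⟩, h₅⟩, h₆⟩, h₇⟩, h₈⟩, h₉⟩, h₁₀⟩, h₁₁⟩, h₁₂⟩, h₁₃⟩

/-- The sentence stating that `k` lines of a given direction never cover. -/
noncomputable def linesSentence (k : ℕ) : rookLang.Sentence :=
  (parallelFormula 0 1 0 1 ⟹ ∼(Term.bdEqual (Term.var (Sum.inr 0)) (Term.var (Sum.inr 1))) ⟹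
    (BoundedFormula.iInf fun i : Fin k =>
      ∼(parallelFormula (Fin.castSucc 0) (Fin.castSucc 1) (Fin.castSucc i.succ.succ)
        (Fin.last (k + 2)))).ex : rookLang.BoundedFormula Empty (k + 2)).alls

theorem realize_linesSentence (k : ℕ) :
    Sentence.Realize N (linesSentence k) ↔ ∀ (a b : N) (x : Fin k → N), Parallel a b a b →
      a ≠ b → ∃ z, ∀ i, ¬ Parallel a b (x i) z := by
  simp only [linesSentence, Sentence.Realize, BoundedFormula.realize_alls,
    BoundedFormula.realize_imp, BoundedFormula.realize_not, BoundedFormula.realize_ex,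
    BoundedFormula.realize_iInf, realize_parallelVar, BoundedFormula.realize_bdEqual,
    Term.realize_var, Sum.elim_inr, Fin.snoc_castSucc, Fin.snoc_last]
  constructor
  · intro h a b x
    exact h (Fin.cons a (Fin.cons b x))
  · intro h xs
    exact h (xs 0) (xs 1) fun i => xs i.succ.succ

/-- The grid `ℕ × ℕ`. -/
instance gridStructure : rookLang.Structure (ℕ × ℕ) where
  funMap f := f.elim
  RelMap {n} r := match n, r with
    | _, RookRel.q => fun v =>
      ((v 0).1 = (v 1).1 ∧ (v 2).1 = (v 3).1) ∨ ((v 0).2 = (v 1).2 ∧ (v 2).2 = (v 3).2)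

/-- The standard coordinates of the grid. -/
def gridCoord : Coord (ℕ × ℕ) ℕ ℕ where
  x := Prod.fst
  y := Prod.snd
  pt a b := (a, b)
  x_pt _ _ := rfl
  y_pt _ _ := rfl
  ext _ _ := Prod.ext
  infX := inferInstance
  infY := inferInstance
  parallel _ _ _ _ := Iff.rfl

/-- The complete theory of the grid. -/
def rookTheory : rookLang.Theory := rookLang.completeTheory (ℕ × ℕ)

theorem exists_isFrame_grid : ∃ a b c d : ℕ × ℕ, IsFrame a b c d := by
  refine ⟨(0, 0), (0, 1), (0, 0), (1, 0), ?_⟩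
  have h := gridCoord.parallel
  simp only [gridCoord] at h
  constructor
  case exists_meet =>
    intro p q
    exact ⟨(p.1, q.2), by simp [h], by simp [h]⟩
  all_goals simp +contextual [h, Prod.ext_iff]

theorem lines_grid (k : ℕ) (a b : ℕ × ℕ) (x : Fin k → ℕ × ℕ) (_ : Parallel a b a b)
    (_ : a ≠ b) : ∃ z, ∀ i, ¬ Parallel a b (x i) z := by
  have h := gridCoord.parallel
  simp only [gridCoord] at h
  obtain ⟨m, hm⟩ := (Set.finite_range fun i => (x i).1).exists_notMem
  obtain ⟨n, hn⟩ := (Set.finite_range fun i => (x i).2).exists_notMem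
  refine ⟨(m, n), fun i hi => ?_⟩
  rw [h] at hi
  rcases hi with hi | hi
  · exact hm ⟨i, hi.2⟩
  · exact hn ⟨i, hi.2⟩

theorem infinite_quotient {a b : N} (s : Setoid N) (hs : ∀ p q, s p q ↔ Parallel a b p q)
    (h : ∀ (k : ℕ) (x : Fin k → N), ∃ z, ∀ i, ¬ Parallel a b (x i) z) : Infinite (Quotient s) := by
  by_contra hfin
  rw [not_infinite_iff_finite] at hfin
  obtain ⟨k, ⟨e⟩⟩ := Finite.exists_equiv_fin (Quotient s)
  obtain ⟨z, hz⟩ := h k fun i => (e.symm i).out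
  refine hz (e ⟦z⟧) ((hs _ _).1 ?_)
  rw [Equiv.symm_apply_apply]
  exact Quotient.mk_out z

/-- Every model of `rookTheory` has coordinates. -/
theorem exists_coord (hN : N ⊨ rookTheory) : ∃ X Y : Type, Nonempty (Coord N X Y) := by
  obtain ⟨a, b, c, d, h⟩ := realize_frameSentence.1 (hN.realize_of_mem frameSentence
    (realize_frameSentence.2 exists_isFrame_grid))
  have hl := fun k => (realize_linesSentence k).1 (hN.realize_of_mem (linesSentence k)
    ((realize_linesSentence k).2 (lines_grid k)))
  let s : Setoid N := ⟨Parallel a b, h.refl, h.symm _ _, h.trans _ _ _⟩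
  let t : Setoid N := ⟨Parallel c d, h.refl', h.symm' _ _, h.trans' _ _ _⟩
  have hs : ∀ p q, (Quotient.mk s p = Quotient.mk s q) ↔ Parallel a b p q := fun p q => Quotient.eq
  have ht : ∀ p q, (Quotient.mk t p = Quotient.mk t q) ↔ Parallel c d p q := fun p q => Quotient.eq
  choose f hf₁ hf₂ using h.exists_meet
  refine ⟨Quotient s, Quotient t, ⟨{
    x := Quotient.mk s
    y := Quotient.mk t
    pt := fun u v => f u.out v.out
    x_pt := fun u v => ((hs _ _).2 (hf₁ _ _)).symm.trans u.out_eq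
    y_pt := fun u v => ((ht _ _).2 (hf₂ _ _)).trans v.out_eq
    ext := fun p q h₁ h₂ => h.eq p q ((hs _ _).1 h₁) ((ht _ _).1 h₂)
    infX := infinite_quotient s (fun _ _ => Iff.rfl) fun k x => hl k a b x h.self h.ne
    infY := infinite_quotient t (fun _ _ => Iff.rfl) fun k x => hl k c d x h.self' h.ne'
    parallel := fun p q r u => by rw [h.parallel, hs, hs, ht, ht] }⟩⟩

end Grid

theorem sameTypeOver_of_matching {N X Y X' Y' α : Type} [rookLang.Structure N] {c : Coord N X Y}
    {c' : Coord N X' Y'} {A : Set N} {u v : α → N}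
    (h : Matching c c' (Sum.elim u (Subtype.val : ↥A → N)) (Sum.elim v Subtype.val)) :
    SameTypeOver (L := rookLang) A u v :=
  fun φ => h.realize_iff φ

section NotBenign

/-- A partial matching in the grid meeting every row but not every column. -/
def shiftedDiagonal : Set (ℕ × ℕ) := Set.range fun i => (i, i + 1)

theorem sameType_shiftedDiagonal :
    SameTypeOver (L := rookLang) shiftedDiagonal ![((0, 2) : ℕ × ℕ)] ![((1, 1) : ℕ × ℕ)] := by
  refine sameTypeOver_of_matching (c := gridCoord) (c' := gridCoord.swap) ⟨?_, ?_⟩ <;>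
  · rintro (i | ⟨_, i, rfl⟩) (j | ⟨_, j, rfl⟩) <;> simp [gridCoord, Coord.swap]
    all_goals exact eq_comm

/-- The formula stating that every line parallel to the one through the variable and the
parameter `a` meets the predicate `P`. -/
def meetsLinesFormula {A : Set (ℕ × ℕ)} (a : A) :
    (rookLang.sum unaryLang).Formula (Fin 1 ⊕ ↥A) :=
  ((Relations.boundedFormula (L := rookLang.sum unaryLang) (n := 1) (l := 2) (Sum.inr ⟨rfl⟩)
      ![Term.var (Sum.inr 1)] ⊓
    Relations.boundedFormula (L := rookLang.sum unaryLang) (n := 4) (l := 2)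
      (Sum.inl RookRel.q)
      ![Term.var (Sum.inl (Sum.inl 0)), Term.var (Sum.inl (Sum.inr a)), Term.var (Sum.inr 0),
        Term.var (Sum.inr 1)] : (rookLang.sum unaryLang).BoundedFormula (Fin 1 ⊕ ↥A) 2).ex.all :
    (rookLang.sum unaryLang).BoundedFormula (Fin 1 ⊕ ↥A) 0)

theorem realize_meetsLinesFormula {A : Set (ℕ × ℕ)} (a : A) (u : Fin 1 → ℕ × ℕ) :
    (letI : unaryLang.Structure (ℕ × ℕ) := unaryStructure A
     (meetsLinesFormula a).Realize (Sum.elim u Subtype.val)) ↔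
      ∀ p, ∃ q ∈ A, Parallel (u 0) (a : ℕ × ℕ) p q := by
  let : unaryLang.Structure (ℕ × ℕ) := unaryStructure A
  simp only [meetsLinesFormula, Formula.Realize, BoundedFormula.realize_all,
    BoundedFormula.realize_ex, BoundedFormula.realize_inf]
  exact Iff.rfl

theorem not_isBenign_shiftedDiagonal : ¬ IsBenign (L := rookLang) shiftedDiagonal := by
  intro h
  have h₁ := h 1 _ _ sameType_shiftedDiagonal (meetsLinesFormula ⟨(0, 1), 0, rfl⟩)
  have h₂ := (realize_meetsLinesFormula _ _).symm.trans (h₁.trans (realize_meetsLinesFormula _ _))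
  have hp := gridCoord.parallel
  simp only [gridCoord] at hp
  obtain ⟨q, ⟨i, rfl⟩, hq⟩ := h₂.1 (fun p => ⟨(p.1, p.1 + 1), ⟨p.1, rfl⟩, by simp [hp]⟩) (0, 0)
  simp [hp] at hq

end NotBenign

section Stability

variable {N X Y α : Type} [rookLang.Structure N]

open Classical in
/-- The position of the values of `f` relative to those of `g`. -/
noncomputable def patternCode {B : Type} (f : α → X) (g : B → X) :
    (α → Option B) × (α → α → Prop) :=
  (fun i => if h : ∃ b, f i = g b then some h.choose else none, fun i j => f i = f j)

theorem samePattern_of_patternCode_eq {X X' B : Type} {f : α → X} {g : B → X} {f' : α → X'}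
    {g' : B → X'} (hg : SamePattern g g') (h : patternCode f g = patternCode f' g') :
    SamePattern (Sum.elim g f) (Sum.elim g' f') := by
  have h₁ : ∀ i b, f i = g b ↔ f' i = g' b := by
    intro i b
    have hi := congrFun (congrArg Prod.fst h) i
    simp only [patternCode] at hi
    by_cases e : ∃ b, f i = g b <;> by_cases e' : ∃ b, f' i = g' b
    · rw [dif_pos e, dif_pos e', Option.some_inj] at hi
      rw [e.choose_spec, e'.choose_spec, hi]
      exact hg _ _
    · rw [dif_pos e, dif_neg e'] at hi
      cases hi
    · rw [dif_neg e, dif_pos e'] at hi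
      cases hi
    · exact iff_of_false (fun e₁ => e ⟨b, e₁⟩) (fun e₁ => e' ⟨b, e₁⟩)
  rintro (i | i) (j | j)
  · exact hg i j
  · exact eq_comm.trans ((h₁ j i).trans eq_comm)
  · exact h₁ i j
  · exact iff_of_eq (congrFun (congrFun (congrArg Prod.snd h) i) j)

theorem exists_coord_matching_of_completeType (c : Coord N X Y) (hN : N ⊨ rookTheory) {A : Set N}
    (p : ((rookLang[[A]]).completeTheory N).CompleteType α) :
    ∃ (K : Type) (_ : rookLang.Structure K) (X' Y' : Type) (c' : Coord K X' Y') (k : A → K)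
      (v : α → K), Matching c c' (Subtype.val : A → N) k ∧
      ∀ φ : rookLang[[A]].Formula α, Formula.equivSentence φ ∈ p ↔
        (BoundedFormula.constantsVarsEquiv φ).Realize (Sum.elim k v) default := by
  have : Nonempty N := ⟨c.pt c.infX.nonempty.some c.infY.nonempty.some⟩
  obtain ⟨K, v, hv⟩ := FirstOrder.Language.Theory.exists_modelType_is_realized_in _ p
  let := (rookLang.lhomWithConstants A).reduct K
  let k : A → K := fun a => ((rookLang.con a : rookLang[[A]].Constants) : K)
  have transfer : ∀ φ : rookLang.Formula A, φ.Realize (Subtype.val : A → N) ↔ φ.Realize k := by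
    intro φ
    have h := realize_iff_of_model_completeTheory (L := rookLang[[A]]) N K
      (Formula.equivSentence φ)
    rw [Formula.realize_equivSentence, Formula.realize_equivSentence] at h
    exact h.symm
  have hK : K ⊨ rookTheory := by
    rw [Theory.model_iff]
    intro σ hσ
    have h := realize_iff_of_model_completeTheory (L := rookLang[[A]]) N K
      ((rookLang.lhomWithConstants A).onSentence σ)
    rw [LHom.realize_onSentence, LHom.realize_onSentence] at h
    exact h.2 (hN.realize_of_mem σ hσ)
  have he : ∀ i j : A, (i : N) = j ↔ k i = k j := by
    intro i j
    have := transfer (Term.equal (Term.var i) (Term.var j))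
    simpa using this
  have hp : ∀ i j l m : A, Parallel (i : N) (j : N) (l : N) (m : N) ↔
      Parallel (k i) (k j) (k l) (k m) := by
    intro i j l m
    have := transfer (parallelVar (Sum.inl i) (Sum.inl j) (Sum.inl l) (Sum.inl m))
    simpa only [Formula.Realize, realize_parallelVar, Sum.elim_inl] using this
  have hmem : ∀ φ : rookLang[[A]].Formula α, Formula.equivSentence φ ∈ p ↔
      (BoundedFormula.constantsVarsEquiv φ).Realize (Sum.elim k v) default := by
    intro φ
    rw [← hv, Theory.CompleteType.formula_mem_typeOf]
    exact BoundedFormula.realize_constantsVarsEquiv.symm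
  obtain ⟨X', Y', ⟨c'⟩⟩ := exists_coord hK
  rcases matching_or_matching_swap c c' he hp with h | h
  exacts [⟨K, _, X', Y', c', k, v, h, hmem⟩, ⟨K, _, Y', X', c'.swap, k, v, h, hmem⟩]

theorem omegaStable_rookTheory : OmegaStable rookLang rookTheory := by
  intro N _ hN A hA n
  obtain ⟨X, Y, ⟨c⟩⟩ := exists_coord hN
  have : Countable A := Cardinal.mk_le_aleph0_iff.1 hA
  choose K _ X' Y' c' k v hk hmem using
    exists_coord_matching_of_completeType (α := Fin n) c hN (A := A)
  rw [Cardinal.mk_le_aleph0_iff]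
  refine Function.Injective.countable (f := fun p =>
    (patternCode (fun i => (c' p).x (v p i)) (fun a => (c' p).x (k p a)),
      patternCode (fun i => (c' p).y (v p i)) (fun a => (c' p).y (k p a)))) fun p q hpq => ?_
  have hx := samePattern_of_patternCode_eq (fun i j => ((hk p).1 i j).symm.trans ((hk q).1 i j))
    (congrArg Prod.fst hpq)
  have hy := samePattern_of_patternCode_eq (fun i j => ((hk p).2 i j).symm.trans ((hk q).2 i j))
    (congrArg Prod.snd hpq)
  have h : Matching (c' p) (c' q) (Sum.elim (k p) (v p)) (Sum.elim (k q) (v q)) := by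
    refine ⟨?_, ?_⟩ <;> rw [comp_elim, comp_elim] <;> assumption
  refine SetLike.ext fun σ => ?_
  obtain ⟨φ, rfl⟩ := Formula.equivSentence.surjective σ
  rw [hmem, hmem]
  exact h.realize_iff (BoundedFormula.constantsVarsEquiv φ)

end Stability

section Rank

theorem MRge.mono {L : FirstOrder.Language.{0, 0}} {N : Type} [L.Structure N] {n : ℕ}
    {D : Set (Fin n → N)} {α β : Ordinal.{0}} (h : MRge (L := L) D α) (hβ : β ≤ α) :
    MRge (L := L) D β := by
  rw [MRge] at h ⊢
  exact ⟨h.1, fun γ hγ => h.2 γ (hγ.trans_le hβ)⟩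

theorem mRge_zero {L : FirstOrder.Language.{0, 0}} {N : Type} [L.Structure N] {n : ℕ}
    {D : Set (Fin n → N)} (h : D.Nonempty) : MRge (L := L) D 0 := by
  rw [MRge]
  exact ⟨h, fun β hβ => absurd hβ (not_lt_bot (a := β))⟩

theorem mRge_succ_iff {L : FirstOrder.Language.{0, 0}} {N : Type} [L.Structure N] {n : ℕ}
    {D : Set (Fin n → N)} {α : Ordinal.{0}} :
    MRge (L := L) D (Order.succ α) ↔ ∃ f : ℕ → Set (Fin n → N),
      (∀ i, f i ∈ DefSet (L := L) N n ∧ f i ⊆ D ∧ MRge (L := L) (f i) α) ∧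
      Pairwise (Function.onFun Disjoint f) := by
  constructor
  · intro h
    rw [MRge] at h
    exact h.2 α (Order.lt_succ α)
  · rintro ⟨f, hf, hd⟩
    rw [MRge]
    refine ⟨?_, fun β hβ =>
      ⟨f, fun i => ⟨(hf i).1, (hf i).2.1, (hf i).2.2.mono (Order.lt_succ_iff.1 hβ)⟩, hd⟩⟩
    have h := (hf 0).2.2
    rw [MRge] at h
    exact h.1.mono (hf 0).2.1

theorem MRge.infinite {L : FirstOrder.Language.{0, 0}} {N : Type} [L.Structure N] {n : ℕ}
    {D : Set (Fin n → N)} (h : MRge (L := L) D 1) : D.Infinite := by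
  rw [← zero_add (1 : Ordinal.{0}), ← Order.succ_eq_add_one, mRge_succ_iff] at h
  obtain ⟨f, hf, hd⟩ := h
  have hne : ∀ i, (f i).Nonempty := fun i => by
    have := (hf i).2.2
    rw [MRge] at this
    exact this.1
  choose v hv using hne
  refine Set.infinite_of_injective_forall_mem (f := v) (fun i j hij => ?_)
    fun i => (hf i).2.1 (hv i)
  by_contra hne
  exact Set.disjoint_left.1 (hd hne) (hv i) (hij ▸ hv j)

variable {N X Y : Type} [rookLang.Structure N]

theorem Coord.setOf_x_eq_mem_defSet (c : Coord N X Y) (a : X) :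
    {v : Fin 1 → N | c.x (v 0) = a} ∈ DefSet (L := rookLang) N 1 := by
  have := c.infY
  obtain ⟨y₁, y₂, hy⟩ := exists_pair_ne Y
  refine ⟨2, parallelVar (Sum.inl (Sum.inr 0)) (Sum.inl (Sum.inr 1)) (Sum.inl (Sum.inl 0))
    (Sum.inl (Sum.inr 0)), ![c.pt a y₁, c.pt a y₂], ?_⟩
  ext v
  simp [Formula.Realize, c.parallel, c.x_pt, c.y_pt, hy]

theorem setOf_eq_mem_defSet (p : N) :
    {v : Fin 1 → N | v 0 = p} ∈ DefSet (L := rookLang) N 1 := by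
  refine ⟨1, Term.equal (Term.var (Sum.inl 0)) (Term.var (Sum.inr 0)), ![p], ?_⟩
  ext v
  simp

theorem Coord.mRge_univ_two (c : Coord N X Y) :
    MRge (L := rookLang) (Set.univ : Set (Fin 1 → N)) 2 := by
  have := c.infX
  have := c.infY
  let a := Infinite.natEmbedding X
  let b := Infinite.natEmbedding Y
  rw [← one_add_one_eq_two, ← Order.succ_eq_add_one, mRge_succ_iff]
  refine ⟨fun i => {v | c.x (v 0) = a i},
    fun i => ⟨c.setOf_x_eq_mem_defSet _, Set.subset_univ _, ?_⟩,
    fun i j hij => Set.disjoint_left.2 fun v hi hj => hij (a.injective (hi.symm.trans hj))⟩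
  rw [← zero_add (1 : Ordinal.{0}), ← Order.succ_eq_add_one, mRge_succ_iff]
  refine ⟨fun j => {v | v 0 = c.pt (a i) (b j)}, fun j => ⟨setOf_eq_mem_defSet _, ?_,
    mRge_zero ⟨![c.pt (a i) (b j)], rfl⟩⟩, fun j k hjk => Set.disjoint_left.2 fun v hj hk => hjk ?_⟩
  · intro v hv
    exact (congrArg c.x hv).trans (c.x_pt _ _)
  · refine b.injective ?_
    rw [← c.y_pt (a i) (b j), ← c.y_pt (a i) (b k), ← show v 0 = _ from hj,
      ← show v 0 = _ from hk]

/-- Two elements are equal or both avoid `S`. -/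
def EqOrAvoid {Z : Type} (S : Set Z) (a b : Z) : Prop := a = b ∨ (a ∉ S ∧ b ∉ S)

/-- Membership in `D` is determined up to moving coordinates outside of `R` and `C`. -/
def Supports (c : Coord N X Y) (R : Set X) (C : Set Y) (D : Set (Fin 1 → N)) : Prop :=
  ∀ v w : Fin 1 → N, EqOrAvoid R (c.x (v 0)) (c.x (w 0)) →
    EqOrAvoid C (c.y (v 0)) (c.y (w 0)) → v ∈ D → w ∈ D

theorem Supports.swap {c : Coord N X Y} {R : Set X} {C : Set Y} {D : Set (Fin 1 → N)}
    (h : Supports c R C D) : Supports c.swap C R D :=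
  fun v w h₁ h₂ => h v w h₂ h₁

theorem samePattern_of_eqOrAvoid {α Z : Type} {f : Fin 1 → Z} {g : Fin 1 → Z} {s : α → Z}
    (h : EqOrAvoid (Set.range s) (f 0) (g 0)) : SamePattern (Sum.elim f s) (Sum.elim g s) := by
  have key : ∀ j, f 0 = s j ↔ g 0 = s j := by
    rcases h with h | ⟨h₁, h₂⟩
    · simp [h]
    · exact fun j => iff_of_false (fun e => h₁ ⟨j, e.symm⟩) (fun e => h₂ ⟨j, e.symm⟩)
  rintro (i | i) (j | j)
  · simp [Subsingleton.elim i j]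
  · rw [Subsingleton.elim i 0]
    exact key j
  · rw [Subsingleton.elim j 0]
    exact eq_comm.trans ((key i).trans eq_comm)
  · rfl

theorem exists_supports (c : Coord N X Y) {D : Set (Fin 1 → N)}
    (hD : D ∈ DefSet (L := rookLang) N 1) :
    ∃ (R : Set X) (C : Set Y), R.Finite ∧ C.Finite ∧ Supports c R C D := by
  obtain ⟨m, φ, b, rfl⟩ := hD
  refine ⟨Set.range fun i => c.x (b i), Set.range fun i => c.y (b i), Set.finite_range _,
    Set.finite_range _, fun v w h₁ h₂ hv => ?_⟩
  have h : Matching c c (Sum.elim v b) (Sum.elim w b) := by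
    refine ⟨?_, ?_⟩ <;> rw [comp_elim, comp_elim] <;> apply samePattern_of_eqOrAvoid <;> assumption
  exact (h.realize_iff φ).1 hv

/-- `D` contains all but finitely many points of the line on which the first coordinate is
`a`. -/
def AlmostContains (c : Coord N X Y) (D : Set (Fin 1 → N)) (a : X) : Prop :=
  ∃ C : Set Y, C.Finite ∧ ∀ w : Fin 1 → N, c.x (w 0) = a → c.y (w 0) ∉ C → w ∈ D

theorem AlmostContains.not_disjoint {c : Coord N X Y} {D D' : Set (Fin 1 → N)} {a : X}
    (h : AlmostContains c D a) (h' : AlmostContains c D' a) : ¬ Disjoint D D' := by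
  obtain ⟨C, hC, h⟩ := h
  obtain ⟨C', hC', h'⟩ := h'
  have := c.infY
  obtain ⟨b, hb⟩ := (hC.union hC').exists_notMem
  rw [Set.mem_union, not_or] at hb
  refine fun hd => Set.disjoint_left.1 hd (h ![c.pt a b] (c.x_pt _ _) ?_)
    (h' _ (c.x_pt _ _) ?_)
  · exact (c.y_pt a b).symm ▸ hb.1
  · exact (c.y_pt a b).symm ▸ hb.2

theorem Coord.finite_inter_line (c : Coord N X Y) {D : Set (Fin 1 → N)}
    (hD : D ∈ DefSet (L := rookLang) N 1) {a : X} (h : ¬ AlmostContains c D a) :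
    (D ∩ {v | c.x (v 0) = a}).Finite := by
  obtain ⟨R, C, -, hC, hs⟩ := exists_supports c hD
  have hmem : ∀ v ∈ D, c.x (v 0) = a → c.y (v 0) ∈ C := by
    intro v hv hva
    by_contra hvC
    exact h ⟨C, hC, fun w hwa hwC => hs v w (Or.inl (hva.trans hwa.symm)) (Or.inr ⟨hvC, hwC⟩) hv⟩
  refine Set.Finite.of_finite_image (f := fun v => c.y (v 0)) (hC.subset ?_) ?_
  · rintro _ ⟨v, ⟨hv, hva⟩, rfl⟩
    exact hmem v hv hva
  · rintro v ⟨-, hv⟩ w ⟨-, hw⟩ h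
    funext i
    rw [Subsingleton.elim i 0]
    exact c.ext _ _ (hv.trans hw.symm) h

theorem Coord.exists_almostContains (c : Coord N X Y) {D : Set (Fin 1 → N)}
    (hD : D ∈ DefSet (L := rookLang) N 1) (hinf : D.Infinite) {R : Set X} {C : Set Y}
    (hR : R.Finite) (hC : C.Finite) (hsub : ∀ v ∈ D, c.x (v 0) ∈ R ∨ c.y (v 0) ∈ C) :
    (∃ a : R, AlmostContains c D a) ∨ ∃ b : C, AlmostContains c.swap D b := by
  by_contra! h
  refine hinf (((hR.biUnion fun a ha => c.finite_inter_line hD (h.1 ⟨a, ha⟩)).union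
    (hC.biUnion fun b hb => c.swap.finite_inter_line hD (h.2 ⟨b, hb⟩))).subset fun v hv => ?_)
  rcases hsub v hv with hv' | hv'
  · exact Or.inl (Set.mem_biUnion hv' ⟨hv, rfl⟩)
  · exact Or.inr (Set.mem_biUnion hv' ⟨hv, rfl⟩)

theorem Coord.not_mRge_two_of_small (c : Coord N X Y) {D : Set (Fin 1 → N)} {R : Set X} {C : Set Y}
    (hR : R.Finite) (hC : C.Finite) (hsub : ∀ v ∈ D, c.x (v 0) ∈ R ∨ c.y (v 0) ∈ C) :
    ¬ MRge (L := rookLang) D 2 := by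
  rw [← one_add_one_eq_two, ← Order.succ_eq_add_one, mRge_succ_iff]
  rintro ⟨f, hf, hd⟩
  have h : ∀ i, ∃ l : R ⊕ C, Sum.elim (fun a : R => AlmostContains c (f i) a)
      (fun b : C => AlmostContains c.swap (f i) b) l := by
    intro i
    rcases c.exists_almostContains (hf i).1 (hf i).2.2.infinite hR hC
      fun v hv => hsub v ((hf i).2.1 hv) with ⟨a, h⟩ | ⟨b, h⟩
    exacts [⟨Sum.inl a, h⟩, ⟨Sum.inr b, h⟩]
  choose l hl using h
  have := hR.to_subtype
  have := hC.to_subtype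
  obtain ⟨i, j, hij, hl'⟩ := Finite.exists_ne_map_eq_of_infinite l
  have hi := hl i
  have hj := hl j
  rw [← hl'] at hj
  cases e : l i with
  | inl a =>
    rw [e] at hi hj
    exact AlmostContains.not_disjoint hi hj (hd hij)
  | inr b =>
    rw [e] at hi hj
    exact AlmostContains.not_disjoint hi hj (hd hij)

theorem Coord.not_mRge_univ_three (c : Coord N X Y) :
    ¬ MRge (L := rookLang) (Set.univ : Set (Fin 1 → N)) 3 := by
  rw [show (3 : Ordinal.{0}) = Order.succ 2 by
    rw [Order.succ_eq_add_one]; exact two_add_one_eq_three.symm, mRge_succ_iff]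
  rintro ⟨f, hf, hd⟩
  have key : ∀ i, ∃ (R : Set X) (C : Set Y), R.Finite ∧ C.Finite ∧
      ∀ v : Fin 1 → N, c.x (v 0) ∉ R → c.y (v 0) ∉ C → v ∈ f i := by
    intro i
    obtain ⟨R, C, hR, hC, hs⟩ := exists_supports c (hf i).1
    by_contra! h
    obtain ⟨v, hvR, hvC, hv⟩ := h R C hR hC
    refine c.not_mRge_two_of_small hR hC (fun w hw => ?_) (hf i).2.2
    by_contra! hw'
    exact hv (hs w v (Or.inr ⟨hw'.1, hvR⟩) (Or.inr ⟨hw'.2, hvC⟩) hw)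
  obtain ⟨R, C, hR, hC, h₀⟩ := key 0
  obtain ⟨R', C', hR', hC', h₁⟩ := key 1
  have := c.infX
  have := c.infY
  obtain ⟨a, ha⟩ := (hR.union hR').exists_notMem
  obtain ⟨b, hb⟩ := (hC.union hC').exists_notMem
  rw [Set.mem_union, not_or] at ha hb
  refine Set.disjoint_left.1 (hd zero_ne_one) (h₀ ![c.pt a b] ?_ ?_) (h₁ _ ?_ ?_)
  · exact (c.x_pt a b).symm ▸ ha.1
  · exact (c.y_pt a b).symm ▸ hb.1
  · exact (c.x_pt a b).symm ▸ ha.2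
  · exact (c.y_pt a b).symm ▸ hb.2

theorem morleyRankTwo_rookTheory : MorleyRankTwo rookLang rookTheory := by
  intro N _ hN _
  obtain ⟨X, Y, ⟨c⟩⟩ := exists_coord hN
  exact ⟨c.mRge_univ_two, c.not_mRge_univ_three⟩

end Rank

section GeneralPosition

variable {X ι κ : Type} {n m : ℕ}

/-- Move the values of `s` outside of `W` off `Z`, keeping those in `W`. -/
theorem exists_move (s : Fin n → X) {W Z : Set X} (hZ : Zᶜ.Infinite) :
    ∃ s' : Fin n → X, (∀ i, s i ∈ W → s' i = s i) ∧ (∀ i, s i ∉ W → s' i ∉ Z) ∧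
      ∀ i j, s i ∉ W → s j ∉ W → (s i = s j ↔ s' i = s' j) := by
  classical
  obtain ⟨k, ⟨e⟩⟩ := Finite.exists_equiv_fin (Set.range s)
  have := hZ.to_subtype
  let g := Infinite.natEmbedding ↥(Zᶜ)
  refine ⟨fun i => if s i ∈ W then s i else g (e (Set.rangeFactorization s i)), fun i hi => if_pos hi,
    fun i hi => ?_, fun i j hi hj => ?_⟩
  · simp only [if_neg hi]
    exact (g _).2
  · simp only [if_neg hi, if_neg hj, Subtype.val_inj, g.injective.eq_iff, Fin.val_inj,
      e.injective.eq_iff]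
    rw [Subtype.ext_iff]
    rfl

/-- The equality patterns over `p` of increasing finite subsequences of `t` agree. -/
def PatternIndisc (p : ι → X) (t : ℕ → Fin m → X) : Prop :=
  ∀ (k : ℕ) (i j : Fin k → ℕ), StrictMono i → StrictMono j →
    SamePattern (Sum.elim (fun s : Fin k × Fin m => t (i s.1) s.2) p)
      (Sum.elim (fun s : Fin k × Fin m => t (j s.1) s.2) p)

theorem PatternIndisc.samePattern {p : ι → X} {t : ℕ → Fin m → X} (h : PatternIndisc p t)
    (l l' : ℕ) : SamePattern (Sum.elim (t l) p) (Sum.elim (t l') p) := by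
  have := h 1 ![l] ![l'] (Subsingleton.strictMono _) (Subsingleton.strictMono _)
  rintro (i | i) (j | j)
  · exact this (Sum.inl (0, i)) (Sum.inl (0, j))
  · exact this (Sum.inl (0, i)) (Sum.inr j)
  · exact this (Sum.inr i) (Sum.inl (0, j))
  · rfl

theorem PatternIndisc.eq_iff {p : ι → X} {t : ℕ → Fin m → X} (h : PatternIndisc p t)
    {a b a' b' : ℕ} (hab : a < b) (hab' : a' < b') (j : Fin m) :
    t a j = t b j ↔ t a' j = t b' j := by
  have mono : ∀ {a b : ℕ}, a < b → StrictMono ![a, b] := by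
    intro a b hab
    rw [Fin.strictMono_iff_lt_succ]
    intro i
    rw [Subsingleton.elim i 0]
    exact hab
  exact h 2 ![a, b] ![a', b'] (mono hab) (mono hab') (Sum.inl (0, j)) (Sum.inl (1, j))

theorem PatternIndisc.eq_of_finite_compl {p : ι → X} {t : ℕ → Fin m → X} (h : PatternIndisc p t)
    (hp : (Set.range p)ᶜ.Finite) (l : ℕ) : t l = t 0 := by
  funext j
  by_cases hj : t 0 j ∈ Set.range p
  · obtain ⟨e, he⟩ := hj
    rw [← he]
    exact ((h.samePattern 0 l (Sum.inl j) (Sum.inr e)).1 he.symm)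
  · have hj' : ∀ l, t l j ∈ (Set.range p)ᶜ := by
      rintro l ⟨e, he⟩
      exact hj ⟨e, ((h.samePattern l 0 (Sum.inl j) (Sum.inr e)).1 he.symm).symm⟩
    have := hp.to_subtype
    obtain ⟨a, b, hab, hab'⟩ := Finite.exists_ne_map_eq_of_infinite
      fun l => (⟨t l j, hj' l⟩ : ↥((Set.range p)ᶜ))
    have hab' : t a j = t b j := congrArg Subtype.val hab'
    rcases Nat.eq_zero_or_pos l with rfl | hl
    · rfl
    · rcases lt_or_gt_of_ne hab with hab | hab
      · exact ((h.eq_iff hab hl j).1 hab').symm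
      · exact ((h.eq_iff hab hl j).1 hab'.symm).symm

/-- The values of `s` over `q` can be put in general position, without splitting over `p`. -/
def Movable (p : ι → X) (q : κ → X) (s : Fin n → X) : Prop :=
  (∀ i, s i ∈ Set.range p) ∨
    ((Set.range q)ᶜ.Infinite ∧ ∀ i, s i ∈ Set.range p ∨ s i ∉ Set.range q) ∨
    (Set.range p)ᶜ.Finite

theorem Movable.exists_generic {p : ι → X} {q : κ → X} {s : Fin n → X} (h : Movable p q s)
    (hpq : Set.range p ⊆ Set.range q) {F : Set X} (hF : F.Finite) :
    ∃ s' : Fin n → X, SamePattern (Sum.elim s q) (Sum.elim s' q) ∧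
      ∀ (m : ℕ) (t : ℕ → Fin m → X), PatternIndisc p t → Set.range (t 0) ⊆ F → ∀ k : ℕ,
        ∃ s'' : Fin n → X, ∀ l < k, SamePattern (Sum.elim s' (t 0)) (Sum.elim s'' (t l)) := by
  have fixed : ∀ (m : ℕ) (t : ℕ → Fin m → X) (s' s'' : Fin n → X) (l : ℕ), PatternIndisc p t →
      (∀ i j, s' i = s' j ↔ s'' i = s'' j) → (∀ i j, s' i = t 0 j ↔ s'' i = t l j) →
      SamePattern (Sum.elim s' (t 0)) (Sum.elim s'' (t l)) := by
    rintro m t s' s'' l ht h₁ h₂ (i | i) (j | j)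
    · exact h₁ i j
    · exact h₂ i j
    · exact eq_comm.trans ((h₂ j i).trans eq_comm)
    · exact ht.samePattern 0 l (Sum.inl i) (Sum.inl j)
  rcases h with h | ⟨hinf, h⟩ | h
  · refine ⟨s, fun _ _ => Iff.rfl, fun m t ht _ k => ⟨s, fun l _ =>
      fixed m t s s l ht (fun _ _ => Iff.rfl) fun i j => ?_⟩⟩
    obtain ⟨e, he⟩ := h i
    rw [← he]
    exact ht.samePattern 0 l (Sum.inr e) (Sum.inl j)
  · obtain ⟨s', h₁, h₂, h₃⟩ := exists_move s (W := Set.range p) (Z := Set.range q ∪ F)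
      (by rw [Set.compl_union, ← Set.sdiff_eq]; exact hinf.sdiff hF)
    have pat : ∀ {Z : Set X} {s' : Fin n → X}, Set.range p ⊆ Z →
        (∀ i, s i ∈ Set.range p → s' i = s i) → (∀ i, s i ∉ Set.range p → s' i ∉ Z) →
        (∀ i j, s i ∉ Set.range p → s j ∉ Set.range p → (s i = s j ↔ s' i = s' j)) →
        ∀ i j, s i = s j ↔ s' i = s' j := by
      intro Z s' hZ h₁ h₂ h₃ i j
      by_cases hi : s i ∈ Set.range p <;> by_cases hj : s j ∈ Set.range p
      · rw [h₁ i hi, h₁ j hj]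
      · refine iff_of_false (fun e => hj (e ▸ hi)) fun e => h₂ j hj (hZ ?_)
        rwa [← e, h₁ i hi]
      · refine iff_of_false (fun e => hi (e ▸ hj)) fun e => h₂ i hi (hZ ?_)
        rwa [e, h₁ j hj]
      · exact h₃ i j hi hj
    have hs' := pat (hpq.trans Set.subset_union_left) h₁ h₂ h₃
    have hq : ∀ i e, s i = q e ↔ s' i = q e := by
      intro i e
      by_cases hi : s i ∈ Set.range p
      · rw [h₁ i hi]
      · exact iff_of_false (fun e' => (h i).resolve_left hi ⟨e, e'.symm⟩)
          fun e' => h₂ i hi (Or.inl ⟨e, e'.symm⟩)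
    refine ⟨s', ?_, fun m t ht ht₀ k => ?_⟩
    · rintro (i | i) (j | j)
      · exact hs' i j
      · exact hq i j
      · exact eq_comm.trans ((hq j i).trans eq_comm)
      · rfl
    · have hfin : (⋃ l ∈ Set.Iio k, Set.range (t l)).Finite :=
        (Set.finite_Iio k).biUnion fun l _ => Set.finite_range _
      obtain ⟨s'', h₁', h₂', h₃'⟩ := exists_move s (W := Set.range p)
        (Z := Set.range q ∪ ⋃ l ∈ Set.Iio k, Set.range (t l))
        (by rw [Set.compl_union, ← Set.sdiff_eq]; exact hinf.sdiff hfin)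
      have hs'' := pat (hpq.trans Set.subset_union_left) h₁' h₂' h₃'
      refine ⟨s'', fun l hl => fixed m t s' s'' l ht
        (fun i j => (hs' i j).symm.trans (hs'' i j)) fun i j => ?_⟩
      by_cases hi : s i ∈ Set.range p
      · rw [h₁ i hi, h₁' i hi]
        obtain ⟨e, he⟩ := hi
        rw [← he]
        exact ht.samePattern 0 l (Sum.inr e) (Sum.inl j)
      · exact iff_of_false (fun e => h₂ i hi (Or.inr (ht₀ ⟨j, e.symm⟩)))
          fun e => h₂' i hi (Or.inr (Set.mem_biUnion hl ⟨j, e.symm⟩))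
  · refine ⟨s, fun _ _ => Iff.rfl, fun m t ht _ k => ⟨s, fun l _ => ?_⟩⟩
    rw [ht.eq_of_finite_compl h l]
    exact fun _ _ => Iff.rfl

end GeneralPosition

section Forking

variable {N X Y : Type} [rookLang.Structure N]

/-- `B` contains two points of a row and two points of a column. -/
def HasFrame (c : Coord N X Y) (B : Set N) : Prop :=
  ∃ p ∈ B, ∃ q ∈ B, ∃ r ∈ B, c.x p = c.x q ∧ c.y p ≠ c.y q ∧ c.y p = c.y r ∧ c.x p ≠ c.x r

theorem HasFrame.swap {c : Coord N X Y} {B : Set N} (h : HasFrame c B) : HasFrame c.swap B := by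
  obtain ⟨p, hp, q, hq, r, hr, h₁, h₂, h₃, h₄⟩ := h
  exact ⟨p, hp, r, hr, q, hq, h₃, h₄, h₁, h₂⟩

theorem HasFrame.mono {c : Coord N X Y} {B C : Set N} (h : HasFrame c B) (hBC : B ⊆ C) :
    HasFrame c C := by
  obtain ⟨p, hp, q, hq, r, hr, h⟩ := h
  exact ⟨p, hBC hp, q, hBC hq, r, hBC hr, h⟩

theorem Coord.exists_frame_of_ne (c : Coord N X Y) {B : Set N} (hB : ElemSubset (L := rookLang) B)
    {p q : N} (hp : p ∈ B) (hq : q ∈ B) (hne : p ≠ q) (hpq : c.x p = c.x q) : HasFrame c B := by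
  have hy : c.y p ≠ c.y q := fun e => hne (c.ext _ _ hpq e)
  have := c.infX
  obtain ⟨a, ha⟩ := exists_ne (c.x p)
  obtain ⟨r, hr, hr'⟩ := hB.2 2 (parallelVar (Sum.inl 0) (Sum.inr 0) (Sum.inl 0) (Sum.inr 0) ⊓
    ∼(parallelVar (Sum.inl 0) (Sum.inl 1) (Sum.inl 0) (Sum.inr 0))) ![p, q]
    (by intro i; fin_cases i; exacts [hp, hq])
    ⟨c.pt a (c.y p), by simp [c.parallel, c.x_pt, c.y_pt, ha.symm, hy]⟩
  simp only [BoundedFormula.realize_inf, BoundedFormula.realize_not, realize_parallelVar,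
    c.parallel, Sum.elim_inl, Sum.elim_inr, Matrix.cons_val_zero, Matrix.cons_val_one,
    Matrix.cons_val_fin_one, hpq, hy, true_and, false_and, or_false, and_self] at hr'
  refine ⟨p, hp, q, hq, r, hr, hpq, hy, ?_, fun e => hr'.2 (hpq.symm.trans e)⟩
  exact hr'.1.resolve_left hr'.2

theorem ElemSubset.hasFrame (c : Coord N X Y) {B : Set N} (hB : ElemSubset (L := rookLang) B) :
    HasFrame c B := by
  obtain ⟨p, hp⟩ := hB.1
  have := c.infX
  obtain ⟨a, ha⟩ := exists_ne (c.x p)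
  obtain ⟨q, hq, hq'⟩ := hB.2 1 (parallelVar (Sum.inl 0) (Sum.inr 0) (Sum.inl 0) (Sum.inr 0) ⊓
    ∼(Term.bdEqual (Term.var (Sum.inl 0)) (Term.var (Sum.inr 0)))) ![p]
    (by intro i; rw [Subsingleton.elim i 0]; exact hp)
    ⟨c.pt a (c.y p), by
      have : p ≠ c.pt a (c.y p) := fun e => ha (by rw [e, c.x_pt])
      simp [c.parallel, c.y_pt, this]⟩
  simp only [BoundedFormula.realize_inf, BoundedFormula.realize_not, realize_parallelVar,
    c.parallel, Sum.elim_inl, Sum.elim_inr, Matrix.cons_val_fin_one, and_self,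
    BoundedFormula.realize_bdEqual, Term.realize_var] at hq'
  obtain ⟨h | h, hne⟩ := hq'
  · exact c.exists_frame_of_ne hB hp hq hne h
  · exact (c.swap.exists_frame_of_ne hB hp hq hne h).swap

theorem HasFrame.matching {α : Type} {c : Coord N X Y} {B : Set N} (hB : HasFrame c B)
    {u v : α → N} (h : SameTypeOver (L := rookLang) B u v) :
    Matching c c (Sum.elim u (Subtype.val : B → N)) (Sum.elim v Subtype.val) := by
  refine (matching_or_matching_swap c c (fun i j => ?_) fun i j k l => ?_).resolve_right fun h' => ?_
  · simpa using h (Term.equal (Term.var i) (Term.var j))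
  · simpa only [Formula.Realize, realize_parallelVar, Sum.elim_inl] using
      h (parallelVar (Sum.inl i) (Sum.inl j) (Sum.inl k) (Sum.inl l))
  · obtain ⟨p, hp, q, hq, -, -, h₁, h₂, -⟩ := hB
    exact h₂ ((h'.1 (Sum.inr ⟨p, hp⟩) (Sum.inr ⟨q, hq⟩)).1 h₁)

theorem HasFrame.patternIndisc {c : Coord N X Y} {C : Set N} (hC : HasFrame c C) {m : ℕ}
    {f : ℕ → Fin m → N} (h : IndiscOver (L := rookLang) C f) :
    PatternIndisc (fun e : C => c.x e) (fun l j => c.x (f l j)) := by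
  intro k i j hi hj
  have := (hC.matching (h k i j hi hj)).1
  rwa [comp_elim, comp_elim] at this

/-- A type in general position on both coordinates does not fork. -/
theorem HasFrame.not_tupForksOver {c : Coord N X Y} {C D : Set N} (hC : HasFrame c C) (hCD : C ⊆ D)
    {n : ℕ} {a : Fin n → N}
    (hx : Movable (fun e : C => c.x e) (fun e : D => c.x e) fun i => c.x (a i))
    (hy : Movable (fun e : C => c.y e) (fun e : D => c.y e) fun i => c.y (a i)) :
    ¬ TupForksOver (L := rookLang) a D C := by
  rintro ⟨r, ms, φ, b, hdiv, hcov⟩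
  obtain ⟨s, hs, hs'⟩ := hx.exists_generic
    (by rintro _ ⟨e, rfl⟩; exact ⟨⟨e, hCD e.2⟩, rfl⟩)
    (Set.finite_iUnion fun i => Set.finite_range fun j => c.x (b i j))
  obtain ⟨t, ht, ht'⟩ := hy.exists_generic
    (by rintro _ ⟨e, rfl⟩; exact ⟨⟨e, hCD e.2⟩, rfl⟩)
    (Set.finite_iUnion fun i => Set.finite_range fun j => c.y (b i j))
  obtain ⟨i, hi⟩ := hcov (fun i => c.pt (s i) (t i)) (sameTypeOver_of_matching (c := c) (c' := c) (by
    refine ⟨?_, ?_⟩ <;> simpa only [comp_elim, c.x_pt, c.y_pt]))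
  obtain ⟨f, hf₀, hf, k, -, hk⟩ := hdiv i
  obtain ⟨s', hs'⟩ := hs' _ _ (hC.patternIndisc hf)
    (by rw [hf₀]; exact Set.subset_iUnion (fun i => Set.range fun j => c.x (b i j)) i) k
  obtain ⟨t', ht'⟩ := ht' _ _ (hC.swap.patternIndisc hf)
    (by rw [hf₀]; exact Set.subset_iUnion (fun i => Set.range fun j => c.y (b i j)) i) k
  refine hk Fin.val Fin.val_strictMono ⟨fun i => c.pt (s' i) (t' i), fun l => ?_⟩
  have h : Matching c c (Sum.elim (fun i => c.pt (s i) (t i)) (f 0))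
      (Sum.elim (fun i => c.pt (s' i) (t' i)) (f l)) := by
    refine ⟨?_, ?_⟩
    · simpa only [comp_elim, c.x_pt] using hs' l l.2
    · rw [comp_elim, comp_elim]
      simp only [c.y_pt]
      exact ht' l l.2
  rw [← hf₀] at hi
  exact (h.realize_iff (φ i)).1 hi

/-- Sharing a generic coordinate is forking. -/
theorem HasFrame.tupForksOver {c : Coord N X Y} {D : Set N} (hD : HasFrame c D)
    (hinf : (Set.range fun e : D => c.x e)ᶜ.Infinite) {n : ℕ} {d : Fin n → N} {i₀ : Fin n}
    (hd : c.x (d i₀) ∉ Set.range fun e : D => c.x e) {e : N} (he : c.x e = c.x (d i₀)) :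
    TupForksOver (L := rookLang) d (D ∪ Set.range ![e]) D := by
  obtain ⟨p, hp, q, hq, -, -, hpq, hpq', -⟩ := hD
  have := hinf.to_subtype
  obtain ⟨z, hz⟩ : ∃ z : ℕ → X, Function.Injective z ∧ z 0 = c.x e ∧
      ∀ l, z l ∉ Set.range fun e : D => c.x e := by
    classical
    let g := Infinite.natEmbedding ↥(Set.range fun e : D => c.x e)ᶜ
    refine ⟨fun l => Equiv.swap (g 0) ⟨c.x (d i₀), hd⟩ (g l), fun l l' h => ?_, ?_, fun l => ?_⟩
    · exact g.injective ((Equiv.swap _ _).injective (Subtype.val_injective h))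
    · simp [he]
    · exact (Equiv.swap (g 0) ⟨c.x (d i₀), hd⟩ (g l)).2
  obtain ⟨hinj, hz₀, hz⟩ := hz
  have hz' : ∀ l, ∀ u ∈ D, z l ≠ c.x u := fun l u hu e => hz l ⟨⟨u, hu⟩, e.symm⟩
  refine ⟨1, fun _ => 3, fun _ => parallelVar (Sum.inl (Sum.inl i₀)) (Sum.inl (Sum.inr 0))
    (Sum.inl (Sum.inr 1)) (Sum.inl (Sum.inr 2)), fun _ => ![e, p, q], fun _ => ?_, fun a ha => ?_⟩
  · refine ⟨fun l => ![c.pt (z l) (c.y e), p, q], ?_, ?_, 2, two_pos, ?_⟩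
    · beta_reduce
      rw [hz₀, c.ext (c.pt (c.x e) (c.y e)) e (c.x_pt _ _) (c.y_pt _ _)]
    · intro k i j hi hj
      have hxpt : ∀ (i : Fin k → ℕ) (s : Fin k × Fin 3),
          c.x ((![c.pt (z (i s.1)) (c.y e), p, q] : Fin 3 → N) s.2) =
            if s.2 = 0 then z (i s.1) else c.x p := by
        rintro i ⟨s, s'⟩
        fin_cases s' <;> simp [c.x_pt, hpq]
      refine sameTypeOver_of_matching (c := c) (c' := c) ⟨?_, ?_⟩
      · rw [comp_elim, comp_elim]
        simp only [hxpt]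
        rintro (s | s) (s' | s')
        · have h₁ := fun l => hz' l p hp
          by_cases hs : s.2 = 0 <;> by_cases hs' : s'.2 = 0 <;>
            simp [hs, hs', hinj.eq_iff, hi.injective.eq_iff, hj.injective.eq_iff, h₁,
              fun l => (h₁ l).symm]
        · have h₁ := fun l => hz' l s' s'.2
          by_cases hs : s.2 = 0 <;> simp [hs, h₁]
        · have h₁ := fun l => (hz' l s s.2).symm
          by_cases hs' : s'.2 = 0 <;> simp [hs', h₁]
        · rfl
      · have hypt : ∀ (i : Fin k → ℕ) (s : Fin k × Fin 3),
            c.y ((![c.pt (z (i s.1)) (c.y e), p, q] : Fin 3 → N) s.2) =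
              (![c.y e, c.y p, c.y q] : Fin 3 → Y) s.2 := by
          rintro i ⟨s, s'⟩
          fin_cases s' <;> simp [c.y_pt]
        rw [comp_elim, comp_elim]
        simp only [hypt]
        exact fun _ _ => Iff.rfl
    · rintro i hi ⟨a, ha⟩
      have key : ∀ j, c.x (a i₀) = z (i j) := by
        intro j
        have := ha j
        simp only [Formula.Realize, realize_parallelVar, Sum.elim_inl, Sum.elim_inr, c.parallel] at this
        simpa [c.x_pt, hpq, hpq'] using this
      exact zero_ne_one (hi.injective (hinj ((key 0).symm.trans (key 1))))
  · refine ⟨0, ?_⟩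
    have h := ha (parallelVar (Sum.inl (Sum.inl i₀)) (Sum.inl (Sum.inr ⟨e, Or.inr ⟨0, rfl⟩⟩))
      (Sum.inl (Sum.inr ⟨p, Or.inl hp⟩)) (Sum.inl (Sum.inr ⟨q, Or.inl hq⟩)))
    simp only [Formula.Realize, realize_parallelVar, Sum.elim_inl, Sum.elim_inr] at h ⊢
    exact h.1 ((c.parallel _ _ _ _).2 (Or.inl ⟨he.symm, hpq⟩))

end Forking

section Orthogonality

variable {N X Y : Type} [rookLang.Structure N]

theorem Coord.x_mem_range_of_mem_aclSet (c : Coord N X Y) {B : Set N} {e : N}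
    (he : e ∈ aclSet (L := rookLang) B) : c.x e ∈ Set.range fun b : B => c.x b := by
  classical
  obtain ⟨φ, hφ, hfin⟩ := he
  by_contra hx
  have := c.infX
  let R : Set X := (fun i => c.x (Sum.elim ![e] (Subtype.val : B → N) i)) '' φ.freeVarFinset
  have hR : R.Finite := φ.freeVarFinset.finite_toSet.image _
  refine hR.infinite_compl ((hfin.image c.x).subset fun a ha => ⟨c.pt a (c.y e), ?_, c.x_pt _ _⟩)
  refine (Matching.realize_iff_of_freeVarFinset (c := c) (c' := c) φ ⟨?_, ?_⟩).1 hφ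
  · have key : ∀ b : B, Sum.inr b ∈ φ.freeVarFinset → a ≠ c.x b :=
      fun b hb h => ha ⟨Sum.inr b, hb, h.symm⟩
    have key' : ∀ b : B, c.x e ≠ c.x b := fun b h => hx ⟨b, h.symm⟩
    rintro ⟨i | i, hi⟩ ⟨j | j, hj⟩
    · simp [Subsingleton.elim i j]
    · obtain rfl := Subsingleton.elim i 0
      simp [c.x_pt, key j hj, key' j]
    · obtain rfl := Subsingleton.elim j 0
      simp [c.x_pt, (key i hi).symm, (key' i).symm]
    · rfl
  · have hy : ∀ i, c.y (Sum.elim ![c.pt a (c.y e)] (Subtype.val : B → N) i) =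
        c.y (Sum.elim ![e] (Subtype.val : B → N) i) := by
      rintro (i | i)
      · simp [c.y_pt]
      · rfl
    intro i j
    simp only [hy]

theorem subset_aclSet {L : FirstOrder.Language.{0, 0}} {N : Type} [L.Structure N] (B : Set N) :
    B ⊆ aclSet (L := L) B := by
  intro b hb
  refine ⟨Term.equal (Term.var (Sum.inl 0)) (Term.var (Sum.inr ⟨b, hb⟩)), by simp, ?_⟩
  refine (Set.finite_singleton b).subset fun y hy => ?_
  simpa using hy

/-- A nonalgebraic tuple has a new coordinate that can be moved infinitely often. -/
theorem HasFrame.exists_generic_coordinate {c : Coord N X Y} {B : Set N} (hB : HasFrame c B) {n : ℕ}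
    {d : Fin n → N} (hd : ¬ AlgebraicTp (L := rookLang) B d) :
    ∃ i, (c.x (d i) ∉ (Set.range fun b : B => c.x b) ∧
        (Set.range fun b : B => c.x b)ᶜ.Infinite) ∨
      (c.y (d i) ∉ (Set.range fun b : B => c.y b) ∧
        (Set.range fun b : B => c.y b)ᶜ.Infinite) := by
  by_contra! h
  have main : ∀ {Z : Type} (g : N → Z) (i : Fin n),
      (g (d i) ∉ (Set.range fun b : B => g b) → ¬ (Set.range fun b : B => g b)ᶜ.Infinite) →
      ∃ S : Set Z, S.Finite ∧ ∀ d' : Fin n → N,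
        SamePattern (fun j => g (Sum.elim d (Subtype.val : B → N) j))
          (fun j => g (Sum.elim d' Subtype.val j)) → g (d' i) ∈ S := by
    intro Z g i hi
    by_cases h : g (d i) ∈ Set.range fun b : B => g b
    · obtain ⟨b, hb⟩ := h
      exact ⟨{g b}, Set.finite_singleton _,
        fun d' hd' => (hd' (Sum.inl i) (Sum.inr b)).1 hb.symm⟩
    · refine ⟨_, Set.not_infinite.1 (hi h), ?_⟩
      rintro d' hd' ⟨b, hb⟩
      exact h ⟨b, ((hd' (Sum.inl i) (Sum.inr b)).2 hb.symm).symm⟩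
  choose S hS hS' using fun i => main c.x i (fun h' => Set.not_infinite.2 ((h i).1 h'))
  choose T hT hT' using fun i => main c.y i (fun h' => Set.not_infinite.2 ((h i).2 h'))
  refine hd ((Set.Finite.pi' fun i => ((hS i).prod (hT i)).image
    fun z => c.pt z.1 z.2).subset fun d' hd' i => ?_)
  have hm := hB.matching hd'
  exact ⟨(c.x (d' i), c.y (d' i)), ⟨hS' i d' hm.1, hT' i d' hm.2⟩,
    c.ext _ _ (c.x_pt _ _) (c.y_pt _ _)⟩

theorem Coord.not_typeOrthSet (c : Coord N X Y) {B A : Set N} (hA : HasFrame c A) (hAB : A ⊆ B)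
    {n : ℕ} {d : Fin n → N} {i : Fin n} (hd : c.x (d i) ∉ Set.range fun b : B => c.x b)
    (hinf : (Set.range fun b : B => c.x b)ᶜ.Infinite) :
    ¬ TypeOrthSet (L := rookLang) B d A := by
  intro h
  let D := B ∪ aclSet (L := rookLang) A
  have hBD : B ⊆ D := Set.subset_union_left
  have hAD : aclSet (L := rookLang) A ⊆ D := Set.subset_union_right
  have range_eq : ∀ {X Y : Type} (c : Coord N X Y),
      (Set.range fun e : D => c.x e) = Set.range fun b : B => c.x b := by
    intro X Y c
    refine Set.Subset.antisymm ?_ ?_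
    · rintro _ ⟨⟨e, he | he⟩, rfl⟩
      · exact ⟨⟨e, he⟩, rfl⟩
      · obtain ⟨b, hb⟩ := c.x_mem_range_of_mem_aclSet he
        exact ⟨⟨b, hAB b.2⟩, hb⟩
    · rintro _ ⟨b, rfl⟩
      exact ⟨⟨b, hBD b.2⟩, rfl⟩
  have movable : ∀ {X Y : Type} (c : Coord N X Y),
      Movable (fun e : B => c.x e) (fun e : D => c.x e) fun i => c.x (d i) := by
    intro X Y c
    by_cases hfin : (Set.range fun b : B => c.x b)ᶜ.Finite
    · exact Or.inr (Or.inr hfin)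
    · rw [Movable, range_eq c]
      exact Or.inr (Or.inl ⟨hfin, fun i => em _⟩)
  obtain ⟨p, hp, -⟩ := id hA
  let e := c.pt (c.x (d i)) (c.y p)
  have hAcl := subset_aclSet (L := rookLang) A
  refine h 1 ![e] D d ![e] hBD hAD (fun _ => Iff.rfl)
    ((hA.mono hAB).not_tupForksOver hBD (movable c) (movable c.swap)) (fun _ => Iff.rfl)
    ((hA.mono hAcl).not_tupForksOver hAD (Or.inr (Or.inl ⟨?_, fun j => Or.inr ?_⟩))
      (Or.inl fun j => ⟨⟨p, hAcl hp⟩, ?_⟩))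
    ((hA.mono (hAB.trans hBD)).tupForksOver ?_ (i₀ := i) ?_ (c.x_pt _ _))
  · rwa [range_eq c]
  · obtain rfl := Subsingleton.elim j 0
    rw [range_eq c]
    change c.x (c.pt (c.x (d i)) (c.y p)) ∉ _
    rwa [c.x_pt]
  · rw [Subsingleton.elim j 0]
    exact (c.y_pt _ _).symm
  · rwa [range_eq c]
  · rwa [range_eq c]

theorem ndop_rookTheory : NDOP rookLang rookTheory := by
  intro N _ hN _ N₀ N₁ N₂ N₃ _ h₁ _ _ _ _ h₃ n d hd
  obtain ⟨X, Y, ⟨c⟩⟩ := exists_coord hN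
  have hsub : N₁ ⊆ N₃ := Set.subset_union_left.trans h₃.2.1
  have hf := h₁.hasFrame c
  left
  obtain ⟨i, ⟨h, hinf⟩ | ⟨h, hinf⟩⟩ := (hf.mono hsub).exists_generic_coordinate hd
  · exact c.not_typeOrthSet hf hsub h hinf
  · exact c.swap.not_typeOrthSet hf.swap hsub h hinf

end Orthogonality

/-- There is an `ω`-stable complete theory of Morley rank `2` with NDOP
having a model `M` and a subset `A ⊆ M` which is not benign in `M`. -/
theorem exists_omega_stable_rank_two_ndop_not_benign :
    ∃ (L : FirstOrder.Language.{0, 0}) (T : L.Theory) (M : Type) (_ : L.Structure M)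
      (A : Set M),
      T.IsComplete ∧ OmegaStable L T ∧ MorleyRankTwo L T ∧ NDOP L T ∧
        M ⊨ T ∧ ¬ IsBenign (L := L) A := by
  refine ⟨rookLang, rookTheory, ℕ × ℕ, gridStructure, shiftedDiagonal,
    completeTheory.isComplete rookLang (ℕ × ℕ), omegaStable_rookTheory, morleyRankTwo_rookTheory,
    ndop_rookTheory, ?_, not_isBenign_shiftedDiagonal⟩
  exact inferInstanceAs ((ℕ × ℕ) ⊨ rookLang.completeTheory (ℕ × ℕ))

end Benign
end

section
/- Let T be a stable theory, M ⊨ T, A ⊆ M, and L* = L ∪ {P} with P naming A. If (M,A) is not weakly benign, then no L*-elementary extension (M',A') of (M,A) is weakly benign. -/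
open FirstOrder Language Cardinal

universe u

namespace Benign

variable {L : FirstOrder.Language.{u, u}} {M : Type u} [L.Structure M]

/-- A formula in variables `α ⊕ δ` involves only finitely many variables from `δ`. -/
theorem exists_finset_formula {L' : FirstOrder.Language.{u, u}} {α : Type*} {δ : Type*}
    (φ : L'.Formula (α ⊕ δ)) :
    ∃ (s : Finset δ) (ψ : L'.Formula (α ⊕ ↥s)),
      ∀ (N : Type u) [L'.Structure N] (v : α → N) (w : δ → N),
        ψ.Realize (Sum.elim v (w ∘ Subtype.val)) ↔ φ.Realize (Sum.elim v w) := by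
  classical
  let f : φ.freeVarFinset → α ⊕ ↥φ.freeVarFinset.toRight := fun a =>
    match a with
    | ⟨Sum.inl x, _⟩ => Sum.inl x
    | ⟨Sum.inr d, hd⟩ => Sum.inr ⟨d, Finset.mem_toRight.2 hd⟩
  refine ⟨φ.freeVarFinset.toRight, φ.restrictFreeVar f, fun N _ v w => ?_⟩
  refine BoundedFormula.realize_restrictFreeVar _ ?_
  rintro ⟨x | d, hd⟩ <;> rfl

/-- The formula expressing that `φ(-, -, w)` is an equivalence relation with at most `k`
classes, in the variables `w`. -/
noncomputable def finiteEquivalenceFormula {L' : FirstOrder.Language.{u, u}}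
    {α : Type} [Finite α] {β : Type*} (φ : L'.Formula ((α ⊕ α) ⊕ β)) (k : ℕ) : L'.Formula β :=
  let R {γ : Type} (a b : α → γ) : L'.Formula (β ⊕ γ) :=
    φ.relabel (Sum.elim (Sum.elim (Sum.inr ∘ a) (Sum.inr ∘ b)) Sum.inl)
  let x : Fin 3 → α → Fin 3 × α := Prod.mk
  let g : Fin (k + 1) → α → Fin (k + 1) × α := Prod.mk
  Formula.iAlls _ (R (x 0) (x 0)) ⊓
    Formula.iAlls _ ((R (x 0) (x 1)).imp (R (x 1) (x 0))) ⊓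
    Formula.iAlls _ ((R (x 0) (x 1)).imp ((R (x 1) (x 2)).imp (R (x 0) (x 2)))) ⊓
    Formula.iAlls _ (Formula.iSup fun p : {p : Fin (k + 1) × Fin (k + 1) // p.1 ≠ p.2} =>
      R (g p.1.1) (g p.1.2))

theorem realize_finiteEquivalenceFormula {L' : FirstOrder.Language.{u, u}}
    {α : Type} [Finite α] {β : Type*} (φ : L'.Formula ((α ⊕ α) ⊕ β)) (k : ℕ)
    {N : Type u} [L'.Structure N] (w : β → N) :
    (finiteEquivalenceFormula φ k).Realize w ↔
      (Equivalence fun u v : α → N => φ.Realize (Sum.elim (Sum.elim u v) w)) ∧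
        ∀ g : Fin (k + 1) → α → N, ∃ i j, i ≠ j ∧
          φ.Realize (Sum.elim (Sum.elim (g i) (g j)) w) := by
  have key {γ : Type} (a b : α → γ) (v : γ → N) :
      (φ.relabel (Sum.elim (Sum.elim (Sum.inr ∘ a) (Sum.inr ∘ b)) Sum.inl) :
        L'.Formula (β ⊕ γ)).Realize (fun c => Sum.elim w v c) ↔
      φ.Realize (Sum.elim (Sum.elim (v ∘ a) (v ∘ b)) w) := by
    rw [Formula.realize_relabel]
    apply iff_of_eq
    congr 1
    ext ((c | c) | c) <;> rfl
  have curried (ι : Type) (Q : (ι → α → N) → Prop) :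
      (∀ v : ι × α → N, Q fun i => v ∘ Prod.mk i) ↔ ∀ v, Q v :=
    ⟨fun H v => H fun p => v p.1 p.2, fun H v => H _⟩
  simp only [finiteEquivalenceFormula, Formula.realize_inf, Formula.realize_iAlls,
    Formula.realize_imp, Formula.realize_iSup, key]
  rw [curried (Fin 3) fun v => φ.Realize (Sum.elim (Sum.elim (v 0) (v 0)) w),
    curried (Fin 3) fun v => φ.Realize (Sum.elim (Sum.elim (v 0) (v 1)) w) →
      φ.Realize (Sum.elim (Sum.elim (v 1) (v 0)) w),
    curried (Fin 3) fun v => φ.Realize (Sum.elim (Sum.elim (v 0) (v 1)) w) →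
      φ.Realize (Sum.elim (Sum.elim (v 1) (v 2)) w) →
      φ.Realize (Sum.elim (Sum.elim (v 0) (v 2)) w),
    curried (Fin (k + 1)) fun v => ∃ p : {p : Fin (k + 1) × Fin (k + 1) // p.1 ≠ p.2},
      φ.Realize (Sum.elim (Sum.elim (v p.1.1) (v p.1.2)) w)]
  constructor
  · rintro ⟨⟨⟨hr, hs⟩, ht⟩, hf⟩
    refine ⟨⟨fun a => hr ![a, a, a], fun {a b} => hs ![a, b, a],
      fun {a b c} => ht ![a, b, c]⟩, fun g => ?_⟩
    obtain ⟨⟨p, hp⟩, hR⟩ := hf g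
    exact ⟨p.1, p.2, hp, hR⟩
  · rintro ⟨he, hf⟩
    refine ⟨⟨⟨fun v => he.refl _, fun v => he.symm⟩, fun v => he.trans⟩, fun g => ?_⟩
    obtain ⟨i, j, hij, hR⟩ := hf g
    exact ⟨⟨(i, j), hij⟩, hR⟩

section Transfer

variable {M' : Type u} [L.Structure M'] {A : Set M} {A' : Set M'} {h : M → M'}

theorem LstarElementary.realize_iff (helem : LstarElementary (L := L) A A' h) {γ : Type*}
    (ψ : (L.sum unaryLang).Formula γ) (v : γ → M) :
    (letI : unaryLang.Structure M := unaryStructure A; ψ.Realize v) ↔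
    (letI : unaryLang.Structure M' := unaryStructure A'; ψ.Realize (h ∘ v)) := by
  classical
  let _ : unaryLang.Structure M := unaryStructure A
  let _ : unaryLang.Structure M' := unaryStructure A'
  let e := ψ.freeVarFinset.equivFin
  have H := helem _ (ψ.restrictFreeVar e) fun i => v (e.symm i)
  have H₁ : Formula.Realize (ψ.restrictFreeVar e)
      (fun i => v (e.symm i)) ↔ ψ.Realize v :=
    BoundedFormula.realize_restrictFreeVar v (by simp)
  have H₂ : Formula.Realize (ψ.restrictFreeVar e)
      (h ∘ fun i => v (e.symm i)) ↔ ψ.Realize (h ∘ v) :=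
    BoundedFormula.realize_restrictFreeVar (h ∘ v) (by simp)
  exact H₁.symm.trans (H.trans H₂)

/-- The atomic formula `P(x)`. -/
def memFormula (L : FirstOrder.Language.{u, u}) {γ : Type*} (x : γ) :
    (L.sum unaryLang).Formula γ :=
  Relations.formula₁ (L := L.sum unaryLang) (Sum.inr ⟨rfl⟩) (Term.var x)

theorem realize_memFormula (A : Set M) {γ : Type*} (x : γ) (v : γ → M) :
    (letI : unaryLang.Structure M := unaryStructure A; (memFormula L x).Realize v) ↔
      v x ∈ A := by
  let _ : unaryLang.Structure M := unaryStructure A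
  exact Formula.realize_rel₁

theorem LstarElementary.mem_iff (helem : LstarElementary (L := L) A A' h) (a : M) :
    a ∈ A ↔ h a ∈ A' := by
  have H := helem.realize_iff (memFormula L ()) fun _ => a
  rwa [realize_memFormula, realize_memFormula] at H

/-- A property of a tuple that holds for all parameters from `A` also holds, after applying
an `L*`-elementary map, for all parameters from `A'`. -/
theorem LstarElementary.forall_params (helem : LstarElementary (L := L) A A' h)
    {α β : Type*} [Finite β] (ψ : L.Formula (α ⊕ β)) (v : α → M)
    (H : ∀ w : β → A, ψ.Realize (Sum.elim v (Subtype.val ∘ w))) (w : β → A') :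
    ψ.Realize (Sum.elim (h ∘ v) (Subtype.val ∘ w)) := by
  let χ : (L.sum unaryLang).Formula α :=
    Formula.iAlls β ((Formula.iInf fun i => memFormula L (Sum.inr i)).imp
      (LHom.sumInl.onFormula ψ))
  have realize_χ {N : Type u} [L.Structure N] (B : Set N) (v : α → N) :
      (letI : unaryLang.Structure N := unaryStructure B; χ.Realize v) ↔
        ∀ w : β → N, (∀ i, w i ∈ B) → ψ.Realize (Sum.elim v w) := by
    let _ : unaryLang.Structure N := unaryStructure B
    refine Formula.realize_iAlls.trans (forall_congr' fun w => ?_)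
    rw [Formula.realize_imp, Formula.realize_iInf, LHom.realize_onFormula]
    exact imp_congr_left (forall_congr' fun i => realize_memFormula B _ _)
  have := (helem.realize_iff χ v).1 ((realize_χ A v).2 fun w hw => H fun i => ⟨w i, hw i⟩)
  exact (realize_χ A' _).1 this _ fun i => (w i).2

theorem LstarElementary.sameTypeOver (helem : LstarElementary (L := L) A A' h) {α : Type}
    {x y : α → M} (hxy : SameTypeOver (L := L) A x y) :
    SameTypeOver (L := L) A' (h ∘ x) (h ∘ y) := by
  intro φ
  obtain ⟨s, ψ, hψ⟩ := exists_finset_formula φ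
  rw [← hψ, ← hψ]
  let χ : L.Formula ((α ⊕ α) ⊕ ↥s) :=
    (ψ.relabel (Sum.map Sum.inl id)).iff (ψ.relabel (Sum.map Sum.inr id))
  have realize_χ {N : Type u} [L.Structure N] (x y : α → N) (w : s → N) :
      χ.Realize (Sum.elim (Sum.elim x y) w) ↔
        (ψ.Realize (Sum.elim x w) ↔ ψ.Realize (Sum.elim y w)) := by
    simp [χ, Sum.elim_comp_map]
  have H := helem.forall_params χ (Sum.elim x y) (fun w => by
    rw [realize_χ]
    simpa [Sum.elim_comp_map] using hxy (ψ.relabel (Sum.map id w))) Subtype.val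
  rwa [Sum.comp_elim, realize_χ] at H

theorem LstarElementary.sameStrongTypeOver (helem : LstarElementary (L := L) A A' h)
    {α : Type} [Finite α] {x y : α → M} (hxy : SameStrongTypeOver (L := L) A x y) :
    SameStrongTypeOver (L := L) A' (h ∘ x) (h ∘ y) := by
  refine ⟨helem.sameTypeOver hxy.1, fun φ hequiv ⟨k, hk⟩ => ?_⟩
  obtain ⟨s, ψ, hψ⟩ := exists_finset_formula φ
  simp only [← hψ] at hequiv hk ⊢
  let χ : L.Formula ((α ⊕ α) ⊕ ↥s) :=
    ((finiteEquivalenceFormula ψ k).relabel Sum.inr).imp ψ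
  have H := helem.forall_params χ (Sum.elim x y) (fun w => by
    simp only [χ, Formula.realize_imp, Formula.realize_relabel, Sum.elim_comp_inr,
      realize_finiteEquivalenceFormula]
    rintro ⟨he, hf⟩
    have H := hxy.2 (ψ.relabel (Sum.map id w))
    simp only [Formula.realize_relabel, Sum.elim_comp_map, Function.comp_id] at H
    exact H he ⟨k, hf⟩) Subtype.val
  simp only [χ, Formula.realize_imp, Formula.realize_relabel, Sum.elim_comp_inr,
    realize_finiteEquivalenceFormula, Sum.comp_elim] at H
  exact H ⟨hequiv, hk⟩

theorem LstarElementary.sameLstarTypeOver_of_comp (helem : LstarElementary (L := L) A A' h)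
    {α : Type} {x y : α → M} (hxy : SameLstarTypeOver (L := L) A' (h ∘ x) (h ∘ y)) :
    SameLstarTypeOver (L := L) A x y := by
  let _ : unaryLang.Structure M := unaryStructure A
  let _ : unaryLang.Structure M' := unaryStructure A'
  intro φ
  let f : A → A' := fun a => ⟨h a, (helem.mem_iff a).1 a.2⟩
  have H := hxy (φ.relabel (Sum.map id f))
  rw [Formula.realize_relabel, Formula.realize_relabel, Sum.elim_comp_map,
    Sum.elim_comp_map] at H
  have Hx := helem.realize_iff φ (Sum.elim x Subtype.val)
  have Hy := helem.realize_iff φ (Sum.elim y Subtype.val)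
  rw [Sum.comp_elim] at Hx Hy
  exact Hx.trans (H.trans Hy.symm)

end Transfer

/-- If `(M, A)` is not weakly benign, then no `L*`-elementary extension
`(M', A')` of `(M, A)` is weakly benign. -/
theorem not_weaklyBenign_of_elementary_extension {L : FirstOrder.Language.{u, u}}
    {M M' : Type u} [L.Structure M] [L.Structure M']
    (hstable : Stable L (L.completeTheory M))
    (A : Set M) (A' : Set M') (h : M → M')
    (helem : LstarElementary (L := L) A A' h)
    (hnwb : ¬ IsWeaklyBenign (L := L) A) :
    ¬ IsWeaklyBenign (L := L) A' := by
  intro hwb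
  exact hnwb fun n x y hxy =>
    helem.sameLstarTypeOver_of_comp (hwb n _ _ (helem.sameStrongTypeOver hxy))

end Benign
end
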